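/- (Representation formula for bounded solutions) Let m > 4 and k ≥ 1 be integers, and let Z_k be the degree-k zonal harmonic. There exists a nonzero constant c = c_{m,k}, depending only on m and k, with the following property. Let f : ℝ^m × ℝ^m → ℝ take values in H_k with C² coefficients and be compactly supported in x, and let g : ℝ^m × ℝ^m → ℝ take values in H_k with C² coefficients, be bounded on ℝ^m × B^m (sup_{y ∈ ℝ^m, v ∈ B^m} |g(y,v)| < ∞), and satisfy (D_k g)(y,v) = f(y,v) for all y ∈ ℝ^m, v ∈ B^m. Then there exists a harmonic polynomial h : ℝ^m → ℝ homogeneous of degree k such that g(y,v) = ∫_{ℝ^m} ∫_{S^{m−1}} c |y−x|^{2−m} Z_k( u − 2⟨u, y−x⟩(y−x)/|y−x|², v ) f(x,u) dS(u) dx + h(v) for all y ∈ ℝ^m and v ∈ B^m. -/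

import Mathlib

open MeasureTheory
open scoped RealInnerProductSpace

noncomputable section

/-- Partial derivative `∂_{x_i} g(x)` of a function of one Euclidean variable. -/
def pd {m : ℕ} {V : Type*} [NormedAddCommGroup V] [NormedSpace ℝ V]
    (g : EuclideanSpace ℝ (Fin m) → V) (i : Fin m) :
    EuclideanSpace ℝ (Fin m) → V :=
  fun x => fderiv ℝ g x (EuclideanSpace.single i 1)

/-- Partial derivative `∂_{x_i} f(x,u)` in the first variable of a function of two
Euclidean variables. -/
def pdx {m : ℕ} {V : Type*} [NormedAddCommGroup V] [NormedSpace ℝ V]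
    (f : EuclideanSpace ℝ (Fin m) → EuclideanSpace ℝ (Fin m) → V) (i : Fin m) :
    EuclideanSpace ℝ (Fin m) → EuclideanSpace ℝ (Fin m) → V :=
  fun x u => fderiv ℝ (fun x' => f x' u) x (EuclideanSpace.single i 1)

/-- Partial derivative `∂_{u_i} f(x,u)` in the second variable of a function of two
Euclidean variables. -/
def pdu {m : ℕ} {V : Type*} [NormedAddCommGroup V] [NormedSpace ℝ V]
    (f : EuclideanSpace ℝ (Fin m) → EuclideanSpace ℝ (Fin m) → V) (i : Fin m) :
    EuclideanSpace ℝ (Fin m) → EuclideanSpace ℝ (Fin m) → V :=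
  fun x u => fderiv ℝ (fun u' => f x u') u (EuclideanSpace.single i 1)

/-- `f(x,u)` takes values in `H_k`: `f(x,u) = Σ_{|α|=k} c_α(x) u^α` with all coefficients
`c_α` satisfying the regularity predicate `P`, and `u ↦ f(x,u)` harmonic for every `x`. -/
def ValuesInHk (m k : ℕ) (P : (EuclideanSpace ℝ (Fin m) → ℝ) → Prop)
    (f : EuclideanSpace ℝ (Fin m) → EuclideanSpace ℝ (Fin m) → ℝ) : Prop :=
  (∃ (s : Finset (Fin m → ℕ)) (c : (Fin m → ℕ) → EuclideanSpace ℝ (Fin m) → ℝ),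
      (∀ α ∈ s, ∑ i, α i = k) ∧ (∀ α ∈ s, P (c α)) ∧
      (∀ x u, f x u = ∑ α ∈ s, c α x * ∏ i, (u i) ^ (α i))) ∧
  (∀ x u, ∑ j, pdu (pdu f j) j x u = 0)

/-- The bosonic Laplacian (higher spin Laplace operator) `D_k`. -/
def bosonicLaplacian (m k : ℕ)
    (f : EuclideanSpace ℝ (Fin m) → EuclideanSpace ℝ (Fin m) → ℝ) :
    EuclideanSpace ℝ (Fin m) → EuclideanSpace ℝ (Fin m) → ℝ :=
  fun x u =>
    (∑ i, pdx (pdx f i) i x u)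
      - (4 / ((m : ℝ) + 2 * k - 2)) * ∑ i, ∑ j, u i * pdu (pdx (pdx f j) i) j x u
      + (4 * ‖u‖ ^ 2 / (((m : ℝ) + 2 * k - 2) * ((m : ℝ) + 2 * k - 4))) *
          ∑ i, ∑ j, pdu (pdu (pdx (pdx f j) i) j) i x u

/-- The surface measure `dS` on the unit sphere `S^{m-1} ⊆ ℝ^m`. -/
def sphereMeasure (m : ℕ) : Measure (Metric.sphere (0 : EuclideanSpace ℝ (Fin m)) 1) :=
  (volume : Measure (EuclideanSpace ℝ (Fin m))).toSphere

/-- The reflection `(w) u (w)/|w|²` of `u` in the direction `w`, as a vector: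
`u - 2⟨u,w⟩ w/|w|²`. -/
def reflVec {m : ℕ} (u w : EuclideanSpace ℝ (Fin m)) : EuclideanSpace ℝ (Fin m) :=
  u - ((2 * ⟪u, w⟫) / ‖w‖ ^ 2) • w

/-- `h : ℝ^m → ℝ` is a harmonic polynomial homogeneous of degree `k`. -/
def IsHarmPolyHom (m k : ℕ) (h : EuclideanSpace ℝ (Fin m) → ℝ) : Prop :=
  (∃ (s : Finset (Fin m → ℕ)) (c : (Fin m → ℕ) → ℝ),
      (∀ α ∈ s, ∑ i, α i = k) ∧ ∀ u, h u = ∑ α ∈ s, c α * ∏ i, (u i) ^ (α i)) ∧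
  (∀ u, ∑ j, pd (pd h j) j u = 0)

/-- `Zk` is the degree-`k` zonal harmonic (reproducing kernel of the degree-`k` real
harmonic homogeneous polynomials over the unit sphere). -/
def IsZonalHarmonic (m k : ℕ)
    (Zk : EuclideanSpace ℝ (Fin m) → EuclideanSpace ℝ (Fin m) → ℝ) : Prop :=
  (∀ v, IsHarmPolyHom m k (fun u => Zk u v)) ∧
  (∀ h : EuclideanSpace ℝ (Fin m) → ℝ, IsHarmPolyHom m k h → ∀ v,
    (∫ u : Metric.sphere (0 : EuclideanSpace ℝ (Fin m)) 1,
      Zk (u : EuclideanSpace ℝ (Fin m)) v * h (u : EuclideanSpace ℝ (Fin m))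
      ∂(sphereMeasure m)) = h v)

/-- The Newton-type potential
`Φ(y,v) = ∫_{ℝ^m}∫_{S^{m-1}} c |y-x|^{2-m} Z_k((y-x)u(y-x)/|y-x|², v) f(x,u) dS(u) dx`. -/
def poissonPotential (m k : ℕ) (c : ℝ)
    (Zk : EuclideanSpace ℝ (Fin m) → EuclideanSpace ℝ (Fin m) → ℝ)
    (f : EuclideanSpace ℝ (Fin m) → EuclideanSpace ℝ (Fin m) → ℝ) :
    EuclideanSpace ℝ (Fin m) → EuclideanSpace ℝ (Fin m) → ℝ :=
  fun y v => ∫ x : EuclideanSpace ℝ (Fin m),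
    ∫ u : Metric.sphere (0 : EuclideanSpace ℝ (Fin m)) 1,
      c * ((‖y - x‖ ^ (m - 2))⁻¹ : ℝ) * Zk (reflVec (u : EuclideanSpace ℝ (Fin m)) (y - x)) v *
        f x (u : EuclideanSpace ℝ (Fin m)) ∂(sphereMeasure m)

section

/-- Euclidean space `ℝ^m`. -/
abbrev Eu (m : ℕ) := EuclideanSpace ℝ (Fin m)

/-- `F` is differentiable at `z` with partial derivatives `D i`. -/
def HasPD {m : ℕ} (F : Eu m → ℝ) (D : Fin m → ℝ) (z : Eu m) : Prop :=
  HasFDerivAt F (∑ i, D i • (EuclideanSpace.proj i : Eu m →L[ℝ] ℝ)) z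

namespace HasPD

variable {m : ℕ} {F G : Eu m → ℝ} {D D' : Fin m → ℝ} {z : Eu m}

lemma pd_eq (h : HasPD F D z) (i : Fin m) : pd F i z = D i := by
  unfold pd
  rw [HasFDerivAt.fderiv h]
  simp

lemma of_differentiableAt (h : DifferentiableAt ℝ F z) : HasPD F (fun i => pd F i z) z := by
  unfold HasPD
  convert! h.hasFDerivAt using 1
  ext x
  simp only [sum_apply, smul_apply, PiLp.proj_apply, smul_eq_mul, pd]
  conv_rhs => rw [← (EuclideanSpace.basisFun (Fin m) ℝ).sum_repr x]
  simp [mul_comm]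

lemma congr_pd (h : HasPD F D z) (hD : ∀ i, D i = D' i) : HasPD F D' z := by
  rwa [funext hD] at h

lemma add (hF : HasPD F D z) (hG : HasPD G D' z) :
    HasPD (fun x => F x + G x) (fun i => D i + D' i) z := by
  unfold HasPD at *
  simp only [add_smul, Finset.sum_add_distrib]
  exact HasFDerivAt.add hF hG

lemma const_mul (c : ℝ) (hF : HasPD F D z) :
    HasPD (fun x => c * F x) (fun i => c * D i) z := by
  unfold HasPD at *
  simp only [mul_smul, ← Finset.smul_sum]
  exact HasFDerivAt.const_mul hF c

lemma sub (hF : HasPD F D z) (hG : HasPD G D' z) :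
    HasPD (fun x => F x - G x) (fun i => D i - D' i) z := by
  unfold HasPD at *
  simp only [sub_smul, Finset.sum_sub_distrib]
  exact HasFDerivAt.sub hF hG

lemma mul (hF : HasPD F D z) (hG : HasPD G D' z) :
    HasPD (fun x => F x * G x) (fun i => F z * D' i + D i * G z) z := by
  unfold HasPD at *
  convert! HasFDerivAt.mul hF hG using 1
  simp only [add_smul, Finset.sum_add_distrib, mul_smul, Finset.smul_sum]
  congr 1
  exact Finset.sum_congr rfl fun i _ => smul_comm _ _ _

lemma const (c : ℝ) : HasPD (fun _ => c) (fun _ => 0) z := by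
  unfold HasPD
  simpa using hasFDerivAt_const c z

lemma sum {ι : Type*} (s : Finset ι) {F : ι → Eu m → ℝ} {D : ι → Fin m → ℝ}
    (h : ∀ j ∈ s, HasPD (F j) (D j) z) :
    HasPD (fun x => ∑ j ∈ s, F j x) (fun i => ∑ j ∈ s, D j i) z := by
  unfold HasPD at *
  convert! HasFDerivAt.fun_sum h using 1
  simp only [Finset.sum_smul]
  exact Finset.sum_comm

lemma coord (a : Fin m) : HasPD (fun x : Eu m => x a) (fun i => if i = a then 1 else 0) z := by
  unfold HasPD
  simpa [ite_smul] using (EuclideanSpace.proj a : Eu m →L[ℝ] ℝ).hasFDerivAt (x := z)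

lemma norm_sq : HasPD (fun x : Eu m => ‖x‖ ^ 2) (fun i => 2 * z i) z := by
  have : (fun x : Eu m => ‖x‖ ^ 2) = fun x => ∑ a, x a * x a := by
    funext x
    rw [EuclideanSpace.real_norm_sq_eq]
    simp only [pow_two]
  rw [this]
  refine (HasPD.sum Finset.univ fun a _ => (coord a).mul (coord a)).congr_pd fun i => ?_
  simp [Finset.sum_add_distrib]
  ring

lemma comp {T : ℝ → ℝ} {T' : ℝ} (hT : HasDerivAt T T' (F z)) (hF : HasPD F D z) :
    HasPD (fun x => T (F x)) (fun i => T' * D i) z := by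
  unfold HasPD at *
  simp only [mul_smul, ← Finset.smul_sum]
  exact HasDerivAt.comp_hasFDerivAt z hT hF

end HasPD

/-- Evaluation of a polynomial at a point of Euclidean space. -/
def ev {m : ℕ} (P : MvPolynomial (Fin m) ℝ) (u : Eu m) : ℝ := MvPolynomial.eval (fun i => u i) P

open MvPolynomial in
lemma HasPD.ev_comp {m n : ℕ} {W : Eu n → Eu m} {D : Fin m → Fin n → ℝ} {z : Eu n}
    (h : ∀ a, HasPD (fun x => W x a) (D a) z) (P : MvPolynomial (Fin m) ℝ) :
    HasPD (fun x => ev P (W x)) (fun i => ∑ a, ev (pderiv a P) (W z) * D a i) z := by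
  induction P using MvPolynomial.induction_on with
  | C c => simpa [ev] using HasPD.const c
  | add p q hp hq =>
    simpa only [ev, map_add, add_mul, Finset.sum_add_distrib] using hp.add hq
  | mul_X p b hp =>
    have := hp.mul (h b)
    simp only [ev, Derivation.leibniz, map_add, smul_eq_mul, map_mul, eval_X, pderiv_X] at this ⊢
    refine this.congr_pd fun i => ?_
    simp only [add_mul, Finset.sum_add_distrib, Finset.sum_mul]
    congr 1
    · rw [Finset.sum_eq_single b] <;> simp +contextual
    · exact Finset.sum_congr rfl fun a _ => by ring

lemma HasPD.ev_id {m : ℕ} (P : MvPolynomial (Fin m) ℝ) (u : Eu m) :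
    HasPD (ev P) (fun i => ev (MvPolynomial.pderiv i P) u) u := by
  refine (HasPD.ev_comp (W := id) (fun a => HasPD.coord a) P).congr_pd fun i => ?_
  simp

lemma pd_ev {m : ℕ} (P : MvPolynomial (Fin m) ℝ) (i : Fin m) :
    pd (ev P) i = ev (MvPolynomial.pderiv i P) :=
  funext fun u => (HasPD.ev_id P u).pd_eq i

lemma contDiff_ev {m : ℕ} (P : MvPolynomial (Fin m) ℝ) {n : WithTop ℕ∞} : ContDiff ℝ n (ev P) := by
  have h := (AnalyticOnNhd.eval_mvPolynomial (𝕜 := ℝ) P).contDiffOn (n := n) uniqueDiffOn_univ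
  rw [contDiffOn_univ] at h
  exact h.comp (f := fun u : Eu m => fun i => u i) (by fun_prop)

lemma pderiv_pderiv_comm {σ R : Type*} [CommRing R] (i j : σ) (P : MvPolynomial σ R) :
    MvPolynomial.pderiv i (MvPolynomial.pderiv j P) =
      MvPolynomial.pderiv j (MvPolynomial.pderiv i P) := by
  have : ⁅(MvPolynomial.pderiv (R := R) i : Derivation R (MvPolynomial σ R) (MvPolynomial σ R)),
      MvPolynomial.pderiv (R := R) j⁆ = 0 := by
    classical
    apply MvPolynomial.derivation_ext
    intro k
    simp only [Derivation.commutator_apply, MvPolynomial.pderiv_X, Derivation.coe_zero,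
      Pi.zero_apply]
    simp [Pi.single_apply, apply_ite]
  have h := congrArg (fun d => d P) this
  simpa [Derivation.commutator_apply, sub_eq_zero] using h

/-- A harmonic polynomial satisfying Euler's identity with degree `c`. -/
structure HarmEuler {m : ℕ} (P : MvPolynomial (Fin m) ℝ) (c : ℝ) : Prop where
  euler : ∑ i, MvPolynomial.X i * MvPolynomial.pderiv i P = MvPolynomial.C c * P
  harm : ∑ i, MvPolynomial.pderiv i (MvPolynomial.pderiv i P) = 0

namespace HarmEuler

variable {m : ℕ} {P : MvPolynomial (Fin m) ℝ} {c : ℝ}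

lemma partialDeriv (h : HarmEuler P c) (a : Fin m) :
    HarmEuler (MvPolynomial.pderiv a P) (c - 1) where
  euler := by
    have := congrArg (MvPolynomial.pderiv a) h.euler
    classical
    simp only [map_sum, Derivation.leibniz, smul_eq_mul, MvPolynomial.pderiv_X,
      Finset.sum_add_distrib, MvPolynomial.pderiv_C, mul_zero, add_zero] at this
    simp only [Pi.single_apply, mul_ite, mul_one, mul_zero] at this
    rw [map_sub, sub_mul, ← this, map_one, one_mul]
    simp [pderiv_pderiv_comm a]
  harm := by
    have := congrArg (MvPolynomial.pderiv a) h.harm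
    simpa [pderiv_pderiv_comm a] using this

lemma sum_ev (h : HarmEuler P c) (u : Eu m) :
    ∑ i, u i * ev (MvPolynomial.pderiv i P) u = c * ev P u := by
  simpa [ev] using congrArg (fun Q => ev Q u) h.euler

lemma sum_ev_pderiv (h : HarmEuler P c) (u : Eu m) :
    ∑ i, ev (MvPolynomial.pderiv i (MvPolynomial.pderiv i P)) u = 0 := by
  simpa [ev] using congrArg (fun Q => ev Q u) h.harm

end HarmEuler

end

section

section ReflectedCalculus

open MvPolynomial (pderiv)

variable {m : ℕ} {v z : Eu m} {P : MvPolynomial (Fin m) ℝ} {c : ℝ}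

/-- The component `-⟨v, z⟩`, equal to `⟨w, z⟩` for the reflection `w` of `v`. -/
def refInner (v z : Eu m) : ℝ := -⟪v, z⟫

/-- The derivative of `P` in direction `z` at the reflection of `v`. -/
def nd (P : MvPolynomial (Fin m) ℝ) (v z : Eu m) : ℝ :=
  ∑ a, z a * ev (pderiv a P) (reflVec v z)

/-- The second derivative of `P` in direction `z` at the reflection of `v`. -/
def nd2 (P : MvPolynomial (Fin m) ℝ) (v z : Eu m) : ℝ :=
  ∑ a, z a * nd (pderiv a P) v z

lemma reflVec_apply (v z : Eu m) (a : Fin m) :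
    reflVec v z a = v a + 2 * refInner v z / ‖z‖ ^ 2 * z a := by
  simp [reflVec, refInner]
  ring

lemma refInner_eq_sum (v z : Eu m) : refInner v z = ∑ a, -v a * z a := by
  simp [refInner, PiLp.inner_apply, mul_comm]

lemma sum_sq_eq (z : Eu m) : ∑ a, z a * z a = ‖z‖ ^ 2 := by
  rw [EuclideanSpace.real_norm_sq_eq]
  simp only [pow_two]

lemma sum_reflVec_mul (hz : z ≠ 0) : ∑ a, reflVec v z a * z a = refInner v z := by
  have hz' : ‖z‖ ^ 2 ≠ 0 := by simpa using hz
  simp only [reflVec_apply, add_mul, Finset.sum_add_distrib, mul_assoc, ← Finset.mul_sum,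
    sum_sq_eq]
  have := refInner_eq_sum v z
  simp only [neg_mul, Finset.sum_neg_distrib] at this
  field_simp
  linarith

lemma sum_reflVec_sq (hz : z ≠ 0) : ∑ a, reflVec v z a * reflVec v z a = ‖v‖ ^ 2 := by
  have hz' : ‖z‖ ^ 2 ≠ 0 := by simpa using hz
  have h1 : ∑ a, reflVec v z a * reflVec v z a =
      ∑ a, reflVec v z a * v a + 2 * refInner v z / ‖z‖ ^ 2 * ∑ a, reflVec v z a * z a := by
    rw [Finset.mul_sum, ← Finset.sum_add_distrib]
    refine Finset.sum_congr rfl fun a _ => ?_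
    conv_lhs => rw [reflVec_apply v z a]
    conv_rhs => rw [reflVec_apply v z a]
    ring
  have h2 : ∑ a, reflVec v z a * v a =
      ∑ a, v a * v a - 2 * refInner v z / ‖z‖ ^ 2 * ∑ a, -v a * z a := by
    rw [Finset.mul_sum, ← Finset.sum_sub_distrib]
    refine Finset.sum_congr rfl fun a _ => ?_
    rw [reflVec_apply v z a]
    ring
  rw [h1, h2, sum_reflVec_mul hz, ← refInner_eq_sum, sum_sq_eq]
  ring

lemma hasPD_refInner : HasPD (refInner v) (fun i => -v i) z := by
  have : refInner v = fun x : Eu m => ∑ a, -v a * x a := funext (refInner_eq_sum v)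
  rw [this]
  refine (HasPD.sum _ fun a _ => (HasPD.coord a).const_mul (-v a)).congr_pd fun i => ?_
  simp

lemma hasPD_reflVec (hz : z ≠ 0) (a : Fin m) :
    HasPD (fun x => reflVec v x a)
      (fun i => 2 / ‖z‖ ^ 2 * (refInner v z * (if i = a then 1 else 0) - reflVec v z i * z a))
      z := by
  have hz' : ‖z‖ ^ 2 ≠ 0 := by simpa using hz
  simp only [reflVec_apply]
  have h := HasPD.comp (F := fun x : Eu m => ‖x‖ ^ 2) (T := fun t => t⁻¹) (z := z)
    (hasDerivAt_inv hz') HasPD.norm_sq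
  have h2 := (HasPD.const (v a)).add
    ((((hasPD_refInner (v := v)).const_mul 2).mul h).mul (HasPD.coord a))
  simp only [div_eq_mul_inv]
  refine h2.congr_pd fun i => ?_
  field_simp
  ring

lemma hasPD_ev (hz : z ≠ 0) (P : MvPolynomial (Fin m) ℝ) :
    HasPD (fun x => ev P (reflVec v x))
      (fun i => 2 / ‖z‖ ^ 2 * (refInner v z * ev (pderiv i P) (reflVec v z) -
        reflVec v z i * nd P v z)) z := by
  refine (HasPD.ev_comp (hasPD_reflVec hz) P).congr_pd fun i => ?_
  have : ∀ a, ev (pderiv a P) (reflVec v z) *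
      (2 / ‖z‖ ^ 2 * (refInner v z * (if i = a then 1 else 0) - reflVec v z i * z a)) =
      2 / ‖z‖ ^ 2 * (refInner v z * (if i = a then ev (pderiv a P) (reflVec v z) else 0) -
        reflVec v z i * (z a * ev (pderiv a P) (reflVec v z))) := by
    intro a
    split_ifs <;> ring
  simp only [this, ← Finset.mul_sum, Finset.sum_sub_distrib, nd]
  simp

lemma hasPD_nd (hz : z ≠ 0) (P : MvPolynomial (Fin m) ℝ) :
    HasPD (nd P v)
      (fun i => ev (pderiv i P) (reflVec v z) + 2 / ‖z‖ ^ 2 *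
        (refInner v z * nd (pderiv i P) v z - reflVec v z i * nd2 P v z)) z := by
  refine (HasPD.sum Finset.univ fun a _ =>
    (HasPD.coord a).mul (hasPD_ev hz (pderiv a P))).congr_pd fun i => ?_
  rw [Finset.sum_add_distrib, add_comm]
  congr 1
  · simp
  · simp only [nd2]
    conv_rhs => rw [nd]
    simp only [mul_sub, Finset.mul_sum, ← Finset.sum_sub_distrib, pderiv_pderiv_comm i]
    exact Finset.sum_congr rfl fun a _ => by ring

lemma sum_mul_ev (P : MvPolynomial (Fin m) ℝ) :
    ∑ i, z i * ev (pderiv i P) (reflVec v z) = nd P v z := rfl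

lemma sum_mul_nd (P : MvPolynomial (Fin m) ℝ) :
    ∑ i, z i * nd (pderiv i P) v z = nd2 P v z := rfl

namespace HarmEuler

lemma sum_reflVec_nd (h : HarmEuler P c) :
    ∑ i, reflVec v z i * nd (pderiv i P) v z = (c - 1) * nd P v z := by
  simp only [nd, Finset.mul_sum]
  rw [Finset.sum_comm]
  refine Finset.sum_congr rfl fun a _ => ?_
  have := (h.partialDeriv a).sum_ev (reflVec v z)
  rw [mul_left_comm, ← this, Finset.mul_sum]
  refine Finset.sum_congr rfl fun i _ => ?_
  rw [pderiv_pderiv_comm]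
  ring

lemma sum_reflVec_nd2 (h : HarmEuler P c) :
    ∑ i, reflVec v z i * nd2 (pderiv i P) v z = (c - 2) * nd2 P v z := by
  simp only [nd2, Finset.mul_sum]
  rw [Finset.sum_comm]
  refine Finset.sum_congr rfl fun a _ => ?_
  have := (h.partialDeriv a).sum_reflVec_nd (v := v) (z := z)
  rw [mul_left_comm, show c - 2 = c - 1 - 1 by ring, ← this, Finset.mul_sum]
  refine Finset.sum_congr rfl fun i _ => ?_
  rw [pderiv_pderiv_comm]
  ring

lemma sum_nd (h : HarmEuler P c) : ∑ i, nd (pderiv i (pderiv i P)) v z = 0 := by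
  simp only [nd]
  rw [Finset.sum_comm]
  refine Finset.sum_eq_zero fun a _ => ?_
  have := (h.partialDeriv a).sum_ev_pderiv (reflVec v z)
  rw [← Finset.mul_sum]
  rw [show ∑ i, ev (pderiv a (pderiv i (pderiv i P))) (reflVec v z) = 0 from ?_, mul_zero]
  rw [← this]
  refine Finset.sum_congr rfl fun i _ => ?_
  rw [pderiv_pderiv_comm a, pderiv_pderiv_comm a]

lemma sum_vec_ev (h : HarmEuler P c) :
    ∑ i, v i * ev (pderiv i P) (reflVec v z) =
      c * ev P (reflVec v z) - 2 * refInner v z / ‖z‖ ^ 2 * nd P v z := by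
  rw [← h.sum_ev (reflVec v z), nd, Finset.mul_sum, ← Finset.sum_sub_distrib]
  refine Finset.sum_congr rfl fun i _ => ?_
  rw [reflVec_apply v z i]
  ring

end HarmEuler

end ReflectedCalculus

end

section

/-- The vector field `h` is differentiable at `z` with divergence `H`. -/
def HasDiv {m : ℕ} (h : Fin m → Eu m → ℝ) (H : ℝ) (z : Eu m) : Prop :=
  ∃ D : Fin m → Fin m → ℝ, (∀ i, HasPD (h i) (D i) z) ∧ ∑ i, D i i = H

namespace HasDiv

variable {m : ℕ} {h k : Fin m → Eu m → ℝ} {H K : ℝ} {z : Eu m}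

lemma add (hh : HasDiv h H z) (hk : HasDiv k K z) :
    HasDiv (fun i x => h i x + k i x) (H + K) z := by
  obtain ⟨D, hD, rfl⟩ := hh
  obtain ⟨D', hD', rfl⟩ := hk
  exact ⟨_, fun i => (hD i).add (hD' i), Finset.sum_add_distrib⟩

lemma const_mul (c : ℝ) (hh : HasDiv h H z) : HasDiv (fun i x => c * h i x) (c * H) z := by
  obtain ⟨D, hD, rfl⟩ := hh
  exact ⟨_, fun i => (hD i).const_mul c, (Finset.mul_sum _ _ _).symm⟩

lemma mul {G : Eu m → ℝ} {E : Fin m → ℝ} (hh : HasDiv h H z) (hG : HasPD G E z) :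
    HasDiv (fun i x => h i x * G x) (∑ i, h i z * E i + H * G z) z := by
  obtain ⟨D, hD, rfl⟩ := hh
  refine ⟨_, fun i => (hD i).mul hG, ?_⟩
  rw [Finset.sum_add_distrib, Finset.sum_mul]

lemma sum {ι : Type*} (s : Finset ι) {h : ι → Fin m → Eu m → ℝ} {H : ι → ℝ}
    (hh : ∀ j ∈ s, HasDiv (h j) (H j) z) :
    HasDiv (fun i x => ∑ j ∈ s, h j i x) (∑ j ∈ s, H j) z := by
  classical
  induction s using Finset.induction_on with
  | empty => exact ⟨fun _ _ => 0, fun i => by simpa using HasPD.const 0, by simp⟩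
  | insert a s ha ih =>
    simp only [Finset.sum_insert ha]
    exact (hh a (Finset.mem_insert_self a s)).add
      (ih fun j hj => hh j (Finset.mem_insert_of_mem hj))

lemma congr_div (hh : HasDiv h H z) (e : H = K) : HasDiv h K z := e ▸ hh

lemma sum_pd (hh : HasDiv h H z) : ∑ i, pd (h i) i z = H := by
  obtain ⟨D, hD, rfl⟩ := hh
  exact Finset.sum_congr rfl fun i _ => (hD i).pd_eq i

end HasDiv

section Divergence

open MvPolynomial (pderiv)

variable {m : ℕ} {v z : Eu m} {P : MvPolynomial (Fin m) ℝ} {c : ℝ}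

lemma hasDiv_coord : HasDiv (fun i (x : Eu m) => x i) m z :=
  ⟨_, fun i => HasPD.coord i, by simp⟩

lemma hasDiv_coord_mul_ev (hz : z ≠ 0) (P : MvPolynomial (Fin m) ℝ) :
    HasDiv (fun i x => x i * ev P (reflVec v x)) (m * ev P (reflVec v z)) z := by
  refine (hasDiv_coord.mul (hasPD_ev hz P)).congr_div ?_
  have : ∑ i, z i * (2 / ‖z‖ ^ 2 * (refInner v z * ev (pderiv i P) (reflVec v z) -
        reflVec v z i * nd P v z)) = 2 / ‖z‖ ^ 2 * (refInner v z *
        ∑ i, z i * ev (pderiv i P) (reflVec v z) - (∑ i, reflVec v z i * z i) * nd P v z) := by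
    simp only [Finset.mul_sum, Finset.sum_mul, ← Finset.sum_sub_distrib]
    exact Finset.sum_congr rfl fun i _ => by ring
  rw [this, sum_mul_ev, sum_reflVec_mul hz]
  ring

lemma HarmEuler.hasDiv_refInner_mul_grad (h : HarmEuler P c) (hz : z ≠ 0) :
    HasDiv (fun i x => refInner v x * ev (pderiv i P) (reflVec v x))
      (-c * ev P (reflVec v z) + (4 - 2 * c) / ‖z‖ ^ 2 * (refInner v z * nd P v z)) z := by
  have hz' : ‖z‖ ^ 2 ≠ 0 := by simpa using hz
  refine ⟨_, fun i => hasPD_refInner.mul (hasPD_ev hz (pderiv i P)), ?_⟩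
  have : ∑ i, (refInner v z * (2 / ‖z‖ ^ 2 * (refInner v z *
        ev (pderiv i (pderiv i P)) (reflVec v z) - reflVec v z i * nd (pderiv i P) v z)) +
        -v i * ev (pderiv i P) (reflVec v z)) =
      refInner v z * (2 / ‖z‖ ^ 2 * (refInner v z *
        ∑ i, ev (pderiv i (pderiv i P)) (reflVec v z) -
        ∑ i, reflVec v z i * nd (pderiv i P) v z)) -
        ∑ i, v i * ev (pderiv i P) (reflVec v z) := by
    simp only [Finset.mul_sum, ← Finset.sum_sub_distrib]
    exact Finset.sum_congr rfl fun i _ => by ring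
  rw [this, h.sum_ev_pderiv, h.sum_reflVec_nd, h.sum_vec_ev]
  field_simp
  ring

lemma HarmEuler.hasDiv_reflVec_mul_nd (h : HarmEuler P c) (hz : z ≠ 0) :
    HasDiv (fun i x => reflVec v x i * nd P v x)
      (c * ev P (reflVec v z) + 2 / ‖z‖ ^ 2 * ((m + c - 2) * (refInner v z * nd P v z) -
        ‖v‖ ^ 2 * nd2 P v z)) z := by
  have hz' : ‖z‖ ^ 2 ≠ 0 := by simpa using hz
  refine ⟨_, fun i => (hasPD_reflVec hz i).mul (hasPD_nd hz P), ?_⟩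
  have : ∑ i, (reflVec v z i * (ev (pderiv i P) (reflVec v z) + 2 / ‖z‖ ^ 2 *
        (refInner v z * nd (pderiv i P) v z - reflVec v z i * nd2 P v z)) +
        2 / ‖z‖ ^ 2 * (refInner v z * (if i = i then 1 else 0) - reflVec v z i * z i) * nd P v z) =
      ∑ i, reflVec v z i * ev (pderiv i P) (reflVec v z) + 2 / ‖z‖ ^ 2 *
        (refInner v z * ∑ i, reflVec v z i * nd (pderiv i P) v z -
          (∑ i, reflVec v z i * reflVec v z i) * nd2 P v z) +
        2 / ‖z‖ ^ 2 * (refInner v z * (∑ _i : Fin m, 1) - ∑ i, reflVec v z i * z i) * nd P v z := by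
    simp only [Finset.mul_sum, Finset.sum_mul, ← Finset.sum_sub_distrib, ← Finset.sum_add_distrib]
    exact Finset.sum_congr rfl fun i _ => by simp only [if_true]; ring
  rw [this, h.sum_ev, h.sum_reflVec_nd, sum_reflVec_sq hz, sum_reflVec_mul hz]
  simp
  ring

lemma HarmEuler.hasDiv_nd_grad (h : HarmEuler P c) (hz : z ≠ 0) :
    HasDiv (fun i x => nd (pderiv i P) v x) (2 * (2 - c) / ‖z‖ ^ 2 * nd2 P v z) z := by
  refine ⟨_, fun i => hasPD_nd hz (pderiv i P), ?_⟩
  rw [Finset.sum_add_distrib, ← Finset.mul_sum, Finset.sum_sub_distrib, ← Finset.mul_sum,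
    h.sum_ev_pderiv, h.sum_nd, h.sum_reflVec_nd2]
  ring

lemma hasDiv_coord_mul_refInner_nd (hz : z ≠ 0) :
    HasDiv (fun i x => x i * (refInner v x * nd P v x))
      ((m + 2) * (refInner v z * nd P v z)) z := by
  refine (hasDiv_coord.mul (hasPD_refInner.mul (hasPD_nd hz P))).congr_div ?_
  have : ∑ i, z i * (refInner v z * (ev (pderiv i P) (reflVec v z) + 2 / ‖z‖ ^ 2 *
        (refInner v z * nd (pderiv i P) v z - reflVec v z i * nd2 P v z)) + -v i * nd P v z) =
      refInner v z * (∑ i, z i * ev (pderiv i P) (reflVec v z) + 2 / ‖z‖ ^ 2 *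
        (refInner v z * ∑ i, z i * nd (pderiv i P) v z -
          (∑ i, reflVec v z i * z i) * nd2 P v z)) + (∑ i, -v i * z i) * nd P v z := by
    simp only [Finset.mul_sum, Finset.sum_mul, ← Finset.sum_sub_distrib, ← Finset.sum_add_distrib]
    exact Finset.sum_congr rfl fun i _ => by ring
  rw [this, ← refInner_eq_sum, sum_mul_ev, sum_mul_nd, sum_reflVec_mul hz]
  ring

/-- The matrix of the symmetrized symbol of the bosonic Laplacian, applied to `P` and evaluated at
the reflection of `v`. -/
def symb (a b : ℝ) (P : MvPolynomial (Fin m) ℝ) (v : Eu m) (j i : Fin m) (z : Eu m) : ℝ :=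
  (if i = j then ev P (reflVec v z) else 0) -
    a / 2 * (reflVec v z i * ev (pderiv j P) (reflVec v z) +
      reflVec v z j * ev (pderiv i P) (reflVec v z)) +
    b * ‖v‖ ^ 2 * ev (pderiv i (pderiv j P)) (reflVec v z)

/-- The contraction of `symb` with `z` in one index. -/
def zsymb (a b : ℝ) (P : MvPolynomial (Fin m) ℝ) (v : Eu m) (j : Fin m) (z : Eu m) : ℝ :=
  z j * ev P (reflVec v z) +
    (-(a / 2)) * (refInner v z * ev (pderiv j P) (reflVec v z) + reflVec v z j * nd P v z) +
    b * ‖v‖ ^ 2 * nd (pderiv j P) v z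

/-- The contraction of `symb` with `z` in both indices. -/
def zzsymb (a b : ℝ) (P : MvPolynomial (Fin m) ℝ) (v : Eu m) (z : Eu m) : ℝ :=
  ‖z‖ ^ 2 * ev P (reflVec v z) - a * (refInner v z * nd P v z) + b * ‖v‖ ^ 2 * nd2 P v z

variable {a b : ℝ}

lemma sum_mul_symb (hz : z ≠ 0) (j : Fin m) :
    ∑ i, z i * symb a b P v j i z = zsymb a b P v j z := by
  have : ∑ i, z i * symb a b P v j i z =
      ∑ i, z i * (if i = j then ev P (reflVec v z) else 0) +
      (-(a / 2)) * ((∑ i, reflVec v z i * z i) * ev (pderiv j P) (reflVec v z) +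
        reflVec v z j * ∑ i, z i * ev (pderiv i P) (reflVec v z)) +
      b * ‖v‖ ^ 2 * ∑ i, z i * ev (pderiv i (pderiv j P)) (reflVec v z) := by
    simp only [symb, Finset.mul_sum, Finset.sum_mul, ← Finset.sum_add_distrib]
    exact Finset.sum_congr rfl fun i _ => by ring
  rw [this, sum_mul_ev, sum_mul_ev, sum_reflVec_mul hz, zsymb]
  simp

lemma sum_mul_zsymb (hz : z ≠ 0) :
    ∑ j, z j * zsymb a b P v j z = zzsymb a b P v z := by
  have : ∑ j, z j * zsymb a b P v j z =
      (∑ j, z j * z j) * ev P (reflVec v z) +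
      (-(a / 2)) * (refInner v z * ∑ j, z j * ev (pderiv j P) (reflVec v z) +
        (∑ j, reflVec v z j * z j) * nd P v z) +
      b * ‖v‖ ^ 2 * ∑ j, z j * nd (pderiv j P) v z := by
    simp only [zsymb, Finset.mul_sum, Finset.sum_mul, ← Finset.sum_add_distrib]
    exact Finset.sum_congr rfl fun i _ => by ring
  rw [this, sum_mul_ev, sum_mul_nd, sum_reflVec_mul hz, sum_sq_eq, zzsymb]
  ring

lemma HarmEuler.hasDiv_symb (h : HarmEuler P c) (hz : z ≠ 0) (ha : a * (m + 2 * c - 2) = 4)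
    (hb : a = b * (m + 2 * c - 4)) (j : Fin m) :
    HasDiv (symb a b P v j)
      ((m * zsymb a b P v j z - (m - a * c) * (z j * ev P (reflVec v z))) / ‖z‖ ^ 2) z := by
  have hz' : ‖z‖ ^ 2 ≠ 0 := by simpa using hz
  have h1 : ∀ i, HasPD (fun x => if i = j then ev P (reflVec v x) else 0)
      (fun l => (if i = j then 1 else 0) * (2 / ‖z‖ ^ 2 *
        (refInner v z * ev (pderiv l P) (reflVec v z) - reflVec v z l * nd P v z))) z := by
    intro i
    split_ifs
    · simpa using hasPD_ev hz P
    · simpa using HasPD.const 0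
  refine ⟨_, fun i => ((h1 i).sub ((((hasPD_reflVec hz i).mul (hasPD_ev hz (pderiv j P))).add
    ((hasPD_reflVec hz j).mul (hasPD_ev hz (pderiv i P)))).const_mul (a / 2))).add
    ((hasPD_ev hz (pderiv i (pderiv j P))).const_mul (b * ‖v‖ ^ 2)), ?_⟩
  have key : ∀ w S Q N Qj Nj : ℝ, ∀ g n w' z' gg nn h' n' d : Fin m → ℝ,
      ∑ i, (d i * (2 / ‖z‖ ^ 2 * (S * g i - w' i * N)) -
        a / 2 * (w' i * (2 / ‖z‖ ^ 2 * (S * gg i - w' i * Nj)) +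
          2 / ‖z‖ ^ 2 * (S * (if i = i then 1 else 0) - w' i * z' i) * Qj +
          (w * (2 / ‖z‖ ^ 2 * (S * nn i - w' i * n i)) +
          2 / ‖z‖ ^ 2 * (S * d i - w' i * Q) * g i)) +
        b * ‖v‖ ^ 2 * (2 / ‖z‖ ^ 2 * (S * h' i - w' i * n' i))) =
      2 / ‖z‖ ^ 2 * (S * ∑ i, d i * g i - (∑ i, d i * w' i) * N -
        a / 2 * (S * (∑ i, w' i * gg i) - (∑ i, w' i * w' i) * Nj +
          (S * (∑ _i : Fin m, 1) - ∑ i, w' i * z' i) * Qj +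
          w * (S * ∑ i, nn i - ∑ i, w' i * n i) + (S * (∑ i, d i * g i) -
            (∑ i, w' i * g i) * Q)) +
        b * ‖v‖ ^ 2 * (S * ∑ i, h' i - ∑ i, w' i * n' i)) := by
    intros
    simp only [Finset.mul_sum, Finset.sum_mul, ← Finset.sum_sub_distrib,
      ← Finset.sum_add_distrib, if_true]
    exact Finset.sum_congr rfl fun i _ => by ring
  rw [key (reflVec v z j) (refInner v z) (z j) (nd P v z) (ev (pderiv j P) (reflVec v z))
    (nd (pderiv j P) v z) (fun i => ev (pderiv i P) (reflVec v z)) (fun i => nd (pderiv i P) v z)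
    (fun i => reflVec v z i) (fun i => z i) (fun i => ev (pderiv i (pderiv j P)) (reflVec v z))
    (fun i => ev (pderiv i (pderiv i P)) (reflVec v z))
    (fun i => ev (pderiv i (pderiv i (pderiv j P))) (reflVec v z))
    (fun i => nd (pderiv i (pderiv j P)) v z) (fun i => if i = j then 1 else 0)]
  rw [h.sum_ev, (h.partialDeriv j).sum_ev, h.sum_ev_pderiv, (h.partialDeriv j).sum_ev_pderiv,
    sum_reflVec_sq hz, sum_reflVec_mul hz, h.sum_reflVec_nd, (h.partialDeriv j).sum_reflVec_nd,
    zsymb]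
  simp only [ite_mul, one_mul, zero_mul, Finset.sum_ite_eq', Finset.mem_univ, if_true,
    Finset.sum_const, Finset.card_univ, Fintype.card_fin, nsmul_eq_mul, mul_one]
  field_simp
  subst hb
  linear_combination (-(refInner v z * ev (pderiv j P) (reflVec v z)) +
    reflVec v z j * nd P v z) * ha

lemma HarmEuler.hasDiv_zsymb (h : HarmEuler P c) (hz : z ≠ 0)
    (hb : a = b * (m + 2 * c - 4)) :
    HasDiv (zsymb a b P v) (m * zzsymb a b P v z / ‖z‖ ^ 2) z := by
  have hz' : ‖z‖ ^ 2 ≠ 0 := by simpa using hz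
  refine (((hasDiv_coord_mul_ev hz P).add (((h.hasDiv_refInner_mul_grad hz).add
    (h.hasDiv_reflVec_mul_nd hz)).const_mul (-(a / 2)))).add
    ((h.hasDiv_nd_grad hz).const_mul (b * ‖v‖ ^ 2))).congr_div ?_
  subst hb
  rw [zzsymb]
  field_simp
  ring

end Divergence

end

section
open scoped ContDiff Topology

/-- A smooth function on `ℝ` supported in a compact subset of `(0, ∞)`. -/
structure RadialWeight (T : ℝ → ℝ) : Prop where
  smooth : ContDiff ℝ ∞ T
  vanish : ∃ α β : ℝ, 0 < α ∧ ∀ x, x ≤ α ∨ β ≤ x → T x = 0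

namespace RadialWeight

variable {m : ℕ} {T : ℝ → ℝ}

lemma deriv (hT : RadialWeight T) : RadialWeight (deriv T) where
  smooth := hT.smooth.iterate_deriv 1
  vanish := by
    obtain ⟨α, β, hα, h⟩ := hT.vanish
    refine ⟨α / 2, β + 1, by linarith, fun x hx => ?_⟩
    have : T =ᶠ[𝓝 x] fun _ => 0 := by
      rcases hx with hx | hx
      · filter_upwards [Iio_mem_nhds (show x < α by linarith)] with y hy using h y (Or.inl hy.le)
      · filter_upwards [Ioi_mem_nhds (show β < x by linarith)] with y hy using h y (Or.inr hy.le)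
    rw [this.deriv_eq, deriv_const]

lemma mul (hT : RadialWeight T) {φ : ℝ → ℝ} (hφ : ∀ x, 0 < x → ContDiffAt ℝ ∞ φ x) :
    RadialWeight (fun x => φ x * T x) where
  smooth := by
    obtain ⟨α, β, hα, h⟩ := hT.vanish
    rw [contDiff_iff_contDiffAt]
    intro x
    rcases lt_or_ge 0 x with hx | hx
    · exact (hφ x hx).mul hT.smooth.contDiffAt
    · refine (contDiffAt_const (c := (0 : ℝ))).congr_of_eventuallyEq ?_
      filter_upwards [Iio_mem_nhds (show x < α by linarith)] with y hy
      rw [h y (Or.inl hy.le), mul_zero]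
  vanish := by
    obtain ⟨α, β, hα, h⟩ := hT.vanish
    exact ⟨α, β, hα, fun x hx => by rw [h x hx, mul_zero]⟩

lemma const_mul (hT : RadialWeight T) (c : ℝ) : RadialWeight (fun x => c * T x) :=
  hT.mul fun _ _ => contDiffAt_const

lemma rpow_mul (hT : RadialWeight T) (p : ℝ) : RadialWeight (fun x => x ^ p * T x) :=
  hT.mul fun _ hx => Real.contDiffAt_rpow_const_of_ne hx.ne'

lemma inv_mul (hT : RadialWeight T) : RadialWeight (fun x => x⁻¹ * T x) :=
  hT.mul fun _ hx => contDiffAt_inv _ hx.ne'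

lemma add {S : ℝ → ℝ} (hT : RadialWeight T) (hS : RadialWeight S) :
    RadialWeight (fun x => T x + S x) where
  smooth := hT.smooth.add hS.smooth
  vanish := by
    obtain ⟨α, β, hα, h⟩ := hT.vanish
    obtain ⟨α', β', hα', h'⟩ := hS.vanish
    refine ⟨min α α', max β β', lt_min hα hα', fun x hx => ?_⟩
    rw [le_min_iff, max_le_iff] at hx
    rw [h x (hx.imp And.left And.left), h' x (hx.imp And.right And.right), add_zero]

lemma hasDerivAt (hT : RadialWeight T) (x : ℝ) : HasDerivAt T (_root_.deriv T x) x :=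
  (hT.smooth.differentiable (by simp) x).hasDerivAt

lemma hasCompactSupport (hT : RadialWeight T) (F : Eu m → ℝ) :
    HasCompactSupport (fun z => T (‖z‖ ^ 2) * F z) := by
  obtain ⟨α, β, hα, h⟩ := hT.vanish
  refine HasCompactSupport.intro (isCompact_closedBall (0 : Eu m) (1 + |β|)) fun z hz => ?_
  rw [h _ (Or.inr ?_), zero_mul]
  simp only [Metric.mem_closedBall, dist_zero_right, not_le] at hz
  nlinarith [le_abs_self β, abs_nonneg β]

lemma eventually_eq_zero (hT : RadialWeight T) :
    (fun z : Eu m => T (‖z‖ ^ 2)) =ᶠ[𝓝 0] fun _ => 0 := by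
  obtain ⟨α, β, hα, h⟩ := hT.vanish
  have : Filter.Tendsto (fun z : Eu m => ‖z‖ ^ 2) (𝓝 0) (𝓝 0) := by
    have := (show Continuous fun z : Eu m => ‖z‖ ^ 2 by fun_prop).tendsto 0
    simpa using this
  filter_upwards [this.eventually (Iio_mem_nhds hα)] with z hz using h _ (Or.inl (le_of_lt hz))

lemma contDiff {n : ℕ} (hT : RadialWeight T) {F : Eu m → ℝ}
    (hF : ∀ z, z ≠ 0 → ContDiffAt ℝ n F z) : ContDiff ℝ n (fun z => T (‖z‖ ^ 2) * F z) := by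
  rw [contDiff_iff_contDiffAt]
  intro z
  by_cases hz : z = 0
  · subst hz
    refine (contDiffAt_const (c := (0 : ℝ))).congr_of_eventuallyEq ?_
    filter_upwards [hT.eventually_eq_zero] with y hy
    rw [hy, zero_mul]
  · exact ((hT.smooth.of_le (by exact_mod_cast le_top)).contDiffAt.comp z
      (contDiff_norm_sq ℝ).contDiffAt).mul (hF z hz)

lemma continuous (hT : RadialWeight T) {F : Eu m → ℝ}
    (hF : ∀ z, z ≠ 0 → ContinuousAt F z) : Continuous (fun z => T (‖z‖ ^ 2) * F z) := by
  rw [continuous_iff_continuousAt]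
  intro z
  by_cases hz : z = 0
  · subst hz
    refine (continuousAt_const (y := (0 : ℝ))).congr ?_
    filter_upwards [hT.eventually_eq_zero] with y hy
    rw [hy, zero_mul]
  · exact (hT.smooth.continuous.comp (continuous_norm.pow 2)).continuousAt.mul (hF z hz)

lemma integrable (hT : RadialWeight T) {F : Eu m → ℝ}
    (hF : ∀ z, z ≠ 0 → ContinuousAt F z) : Integrable (fun z => T (‖z‖ ^ 2) * F z) :=
  (hT.continuous hF).integrable_of_hasCompactSupport (hT.hasCompactSupport F)

end RadialWeight

lemma integral_pd_eq_zero {m : ℕ} {F : Eu m → ℝ} (hF : ContDiff ℝ 1 F)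
    (hs : HasCompactSupport F) (i : Fin m) :
    Integrable (pd F i) ∧ ∫ z, pd F i z = 0 := by
  have hi : Integrable (pd F i) :=
    ((hF.continuous_fderiv one_ne_zero).clm_apply continuous_const).integrable_of_hasCompactSupport
      (hs.fderiv_apply (𝕜 := ℝ) (EuclideanSpace.single i 1))
  refine ⟨hi, ?_⟩
  have := integral_mul_fderiv_eq_neg_fderiv_mul_of_integrable (μ := (volume : Measure (Eu m)))
    (f := fun _ => (1 : ℝ)) (g := F) (v := EuclideanSpace.single i (1 : ℝ))
    (by simp) (by simpa [pd] using! hi)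
    (by simpa using hF.continuous.integrable_of_hasCompactSupport hs)
    (fun x _ => differentiableAt_const _) (fun x _ => hF.differentiable (by simp) x)
  simpa [pd] using this

lemma ae_ne_zero {m : ℕ} (hm : 0 < m) : ∀ᵐ z : Eu m, z ≠ 0 := by
  have : Nontrivial (Eu m) := by
    have : Nonempty (Fin m) := ⟨⟨0, hm⟩⟩
    infer_instance
  have : NullSingletonClass (volume : Measure (Eu m)) := inferInstance
  rw [ae_iff]
  simp

/-- The divergence theorem for a vector field cut off by a radial weight. -/
theorem RadialWeight.integral_divergence {m : ℕ} (hm : 0 < m) {T T' : ℝ → ℝ}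
    (hT : RadialWeight T) (hT' : ∀ x, 0 < x → HasDerivAt T (T' x) x)
    {h : Fin m → Eu m → ℝ} {H N : Eu m → ℝ}
    (hh : ∀ z, z ≠ 0 → ∀ i, ContDiffAt ℝ 1 (h i) z) (hH : ∀ z, z ≠ 0 → HasDiv h (H z) z)
    (hN : ∀ z, z ≠ 0 → ∑ i, z i * h i z = N z) :
    Integrable (fun z : Eu m => 2 * T' (‖z‖ ^ 2) * N z + T (‖z‖ ^ 2) * H z) ∧
      ∫ z : Eu m, (2 * T' (‖z‖ ^ 2) * N z + T (‖z‖ ^ 2) * H z) = 0 := by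
  have hC : ∀ i, ContDiff ℝ 1 fun z => T (‖z‖ ^ 2) * h i z := fun i =>
    hT.contDiff (n := 1) fun z hz => hh z hz i
  have hI := fun i => integral_pd_eq_zero (hC i) (hT.hasCompactSupport (h i)) i
  have hsum : ∫ z : Eu m, ∑ i, pd (fun z => T (‖z‖ ^ 2) * h i z) i z = 0 := by
    rw [integral_finsetSum _ fun i _ => (hI i).1]
    exact Finset.sum_eq_zero fun i _ => (hI i).2
  have hae : (fun z : Eu m => ∑ i, pd (fun z => T (‖z‖ ^ 2) * h i z) i z) =ᵐ[volume]
      fun z => 2 * T' (‖z‖ ^ 2) * N z + T (‖z‖ ^ 2) * H z := by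
    filter_upwards [ae_ne_zero hm] with z hz
    have h1 : HasPD (fun x : Eu m => T (‖x‖ ^ 2)) _ z :=
      HasPD.comp (hT' (‖z‖ ^ 2) (by positivity)) HasPD.norm_sq
    have h2 := ((hH z hz).mul h1).sum_pd
    simp only [mul_comm (T _)]
    rw [h2, ← hN z hz, Finset.mul_sum]
    congr 1
    exact Finset.sum_congr rfl fun i _ => by ring
  exact ⟨(integrable_finsetSum _ fun i _ => (hI i).1).congr hae,
    (integral_congr_ae hae).symm.trans hsum⟩

end

section
open scoped ContDiff Topology

section Regularity

open MvPolynomial (pderiv)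

variable {m : ℕ} {v z : Eu m} {P : MvPolynomial (Fin m) ℝ} {n : ℕ∞} {a b : ℝ}

lemma contDiffAt_refInner : ContDiffAt ℝ n (refInner v) z := by
  unfold refInner
  exact (contDiffAt_const.inner ℝ contDiffAt_id).neg

lemma contDiffAt_reflVec (hz : z ≠ 0) : ContDiffAt ℝ n (reflVec v) z := by
  have hz' : ‖z‖ ^ 2 ≠ 0 := by simpa using hz
  have : ContDiffAt ℝ n (fun w : Eu m => ‖w‖ ^ 2) z := (contDiff_norm_sq ℝ).contDiffAt
  unfold reflVec
  exact contDiffAt_const.sub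
    ((ContDiffAt.div
    (contDiffAt_const.mul (contDiffAt_const.inner ℝ contDiffAt_id)) this hz').smul contDiffAt_id)

lemma contDiffAt_ev (hz : z ≠ 0) : ContDiffAt ℝ n (fun x => ev P (reflVec v x)) z :=
  (contDiff_ev P).contDiffAt.comp z (contDiffAt_reflVec hz)

lemma contDiffAt_coord (i : Fin m) : ContDiffAt ℝ n (fun x : Eu m => x i) z := by
  fun_prop

lemma contDiffAt_nd (hz : z ≠ 0) : ContDiffAt ℝ n (nd P v) z :=
  ContDiffAt.sum fun i _ => (contDiffAt_coord i).mul (contDiffAt_ev hz)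

lemma contDiffAt_nd2 (hz : z ≠ 0) : ContDiffAt ℝ n (nd2 P v) z :=
  ContDiffAt.sum fun i _ => (contDiffAt_coord i).mul (contDiffAt_nd hz)

lemma contDiffAt_reflVec_apply (hz : z ≠ 0) (i : Fin m) :
    ContDiffAt ℝ n (fun x => reflVec v x i) z :=
  (contDiffAt_coord i).comp z (contDiffAt_reflVec hz)

lemma contDiffAt_symb (hz : z ≠ 0) (j i : Fin m) : ContDiffAt ℝ n (symb a b P v j i) z := by
  unfold symb
  refine (ContDiffAt.sub ?_ (contDiffAt_const.mul
    (((contDiffAt_reflVec_apply hz i).mul (contDiffAt_ev hz)).add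
      ((contDiffAt_reflVec_apply hz j).mul (contDiffAt_ev hz))))).add
    (contDiffAt_const.mul (contDiffAt_ev hz))
  split_ifs
  · exact contDiffAt_ev hz
  · exact contDiffAt_const

lemma contDiffAt_zsymb (hz : z ≠ 0) (j : Fin m) : ContDiffAt ℝ n (zsymb a b P v j) z :=
  (((contDiffAt_coord j).mul (contDiffAt_ev hz)).add (contDiffAt_const.mul
    ((contDiffAt_refInner.mul (contDiffAt_ev hz)).add
      ((contDiffAt_reflVec_apply hz j).mul (contDiffAt_nd hz))))).add
    (contDiffAt_const.mul (contDiffAt_nd hz))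

lemma contDiffAt_zzsymb (hz : z ≠ 0) : ContDiffAt ℝ n (zzsymb a b P v) z :=
  (((contDiff_norm_sq ℝ).contDiffAt.mul (contDiffAt_ev hz)).sub (contDiffAt_const.mul
    (contDiffAt_refInner.mul (contDiffAt_nd hz)))).add
    (contDiffAt_const.mul (contDiffAt_nd2 hz))

end Regularity

/-- The kernel obtained by letting the bosonic Laplacian act on the other factor of the cut-off
fundamental solution; `τ` is the derivative of the cut-off times `‖z‖ ^ (2 - m)`. -/
def cutoffKernel {m : ℕ} (a b c : ℝ) (P : MvPolynomial (Fin m) ℝ) (v : Eu m) (τ : ℝ → ℝ)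
    (z : Eu m) : ℝ :=
  (4 * deriv τ (‖z‖ ^ 2) + (2 * m + 4) * ((‖z‖ ^ 2)⁻¹ * τ (‖z‖ ^ 2))) * zzsymb a b P v z -
    2 * (m - a * c) * (τ (‖z‖ ^ 2) * ev P (reflVec v z))

lemma integral_eq_of_combination {α : Type*} [MeasurableSpace α] {μ : Measure α}
    {A B C K F : α → ℝ} (hA : Integrable A μ ∧ ∫ x, A x ∂μ = 0)
    (hB : Integrable B μ ∧ ∫ x, B x ∂μ = 0) (hC : Integrable C μ ∧ ∫ x, C x ∂μ = 0)
    (hK : Integrable K μ) (hF : ∀ᵐ x ∂μ, F x = K x + A x - B x + C x) :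
    ∫ x, F x ∂μ = ∫ x, K x ∂μ := by
  rw [integral_congr_ae (g := K + A - B + C) hF, integral_add' ((hK.add hA.1).sub hB.1) hC.1,
    integral_sub' (hK.add hA.1) hB.1, integral_add' hK hA.1, hA.2, hB.2, hC.2]
  ring

section IntegrationByParts

variable {m : ℕ} {v : Eu m} {P : MvPolynomial (Fin m) ℝ} {a b c : ℝ} {T τ : ℝ → ℝ}

lemma RadialWeight.cutoffKernel_mul (hτ : RadialWeight τ) {G : Eu m → ℝ} (hG : Continuous G) :
    Continuous (fun z => cutoffKernel a b c P v τ z * G z) ∧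
      HasCompactSupport (fun z => cutoffKernel a b c P v τ z * G z) := by
  have hS := (hτ.deriv.const_mul 4).add (hτ.inv_mul.const_mul (2 * m + 4))
  have hU := hτ.const_mul (2 * (m - a * c))
  have h1 : ∀ z, z ≠ 0 → ContinuousAt (fun z => zzsymb a b P v z * G z) z := fun z hz =>
    (contDiffAt_zzsymb (n := 0) hz).continuousAt.mul hG.continuousAt
  have h2 : ∀ z, z ≠ 0 → ContinuousAt (fun z => ev P (reflVec v z) * G z) z := fun z hz =>
    (contDiffAt_ev (n := 0) hz).continuousAt.mul hG.continuousAt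
  have e : (fun z => cutoffKernel a b c P v τ z * G z) = (fun z =>
      (4 * _root_.deriv τ (‖z‖ ^ 2) + (2 * m + 4) * ((‖z‖ ^ 2)⁻¹ * τ (‖z‖ ^ 2))) *
        (zzsymb a b P v z * G z)) - fun z =>
      (2 * (m - a * c) * τ (‖z‖ ^ 2)) * (ev P (reflVec v z) * G z) := by
    funext z
    simp only [cutoffKernel, Pi.sub_apply]
    ring
  rw [e]
  exact ⟨(hS.continuous h1).sub (hU.continuous h2),
    (hS.hasCompactSupport _).sub (hU.hasCompactSupport _)⟩

/-- Integration by parts for the bosonic Laplacian against a cut-off fundamental solution. -/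
theorem HarmEuler.integral_symb_eq (h : HarmEuler P c) (hm : 0 < m)
    (ha : a * (m + 2 * c - 2) = 4) (hb : a = b * (m + 2 * c - 4))
    (hT : RadialWeight T) (hτ : RadialWeight τ)
    (hTτ : ∀ x, 0 < x → HasDerivAt T ((1 - m / 2) * (x⁻¹ * T x) + τ x) x)
    {G : Eu m → ℝ} (hG : ContDiff ℝ 2 G) :
    ∫ z : Eu m, T (‖z‖ ^ 2) * ∑ j, ∑ i, symb a b P v j i z * pd (pd G j) i z =
      ∫ z : Eu m, cutoffKernel a b c P v τ z * G z := by
  have hG1 : ∀ j, ContDiff ℝ 1 (pd G j) := fun j =>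
    (hG.fderiv_right (m := 1) (by norm_num)).clm_apply contDiff_const
  have hPG : ∀ z, HasPD G (fun i => pd G i z) z := fun z =>
    HasPD.of_differentiableAt (hG.differentiable (by simp) z)
  have hPG1 : ∀ j z, HasPD (pd G j) (fun i => pd (pd G j) i z) z := fun j z =>
    HasPD.of_differentiableAt ((hG1 j).differentiable (by simp) z)
  have hS : RadialWeight (fun x => 2 * (x⁻¹ * T x) + 2 * τ x) :=
    (hT.inv_mul.const_mul 2).add (hτ.const_mul 2)
  have hU : RadialWeight (fun x => (m - a * c) * (x⁻¹ * T x)) := hT.inv_mul.const_mul _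
  have hi : ∀ x, 0 < x → HasDerivAt (fun x => x⁻¹ * T x)
      (-(x ^ 2)⁻¹ * T x + x⁻¹ * ((1 - m / 2) * (x⁻¹ * T x) + τ x)) x := fun x hx =>
    (hasDerivAt_inv hx.ne').mul (hTτ x hx)
  have hA := hT.integral_divergence hm hTτ
    (h := fun i z => ∑ j, symb a b P v j i z * pd G j z)
    (H := fun z => ∑ j, (∑ i, symb a b P v j i z * pd (pd G j) i z +
      (m * zsymb a b P v j z - (m - a * c) * (z j * ev P (reflVec v z))) / ‖z‖ ^ 2 * pd G j z))
    (N := fun z => ∑ j, zsymb a b P v j z * pd G j z)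
    (fun z hz i => ContDiffAt.sum fun j _ =>
      (contDiffAt_symb (n := 1) hz j i).mul (hG1 j).contDiffAt)
    (fun z hz => HasDiv.sum _ fun j _ => (h.hasDiv_symb hz ha hb j).mul (hPG1 j z))
    (fun z hz => by
      simp only [Finset.mul_sum]
      rw [Finset.sum_comm]
      refine Finset.sum_congr rfl fun j _ => ?_
      rw [← sum_mul_symb hz, Finset.sum_mul]
      exact Finset.sum_congr rfl fun i _ => by ring)
  have hB := hS.integral_divergence hm (fun x hx => ((hi x hx).const_mul 2).add
      ((hτ.hasDerivAt x).const_mul 2))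
    (h := fun j z => zsymb a b P v j z * G z)
    (H := fun z => ∑ j, zsymb a b P v j z * pd G j z +
      m * zzsymb a b P v z / ‖z‖ ^ 2 * G z)
    (N := fun z => zzsymb a b P v z * G z)
    (fun z hz i => (contDiffAt_zsymb (n := 1) hz i).mul (hG.of_le (by norm_num)).contDiffAt)
    (fun z hz => (h.hasDiv_zsymb hz hb).mul (hPG z))
    (fun z hz => by rw [← sum_mul_zsymb hz, Finset.sum_mul]; simp only [mul_assoc])
  have hC := hU.integral_divergence hm (fun x hx => (hi x hx).const_mul _)
    (h := fun j z => z j * ev P (reflVec v z) * G z)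
    (H := fun z => ∑ j, z j * ev P (reflVec v z) * pd G j z + m * ev P (reflVec v z) * G z)
    (N := fun z => ‖z‖ ^ 2 * (ev P (reflVec v z) * G z))
    (fun z hz i => ((contDiffAt_coord (n := 1) i).mul (contDiffAt_ev (n := 1) hz)).mul
      (hG.of_le (by norm_num)).contDiffAt)
    (fun z hz => (hasDiv_coord_mul_ev hz P).mul (hPG z))
    (fun z hz => by
      rw [← sum_sq_eq, Finset.sum_mul]
      exact Finset.sum_congr rfl fun i _ => by ring)
  have hK : Integrable (fun z => cutoffKernel a b c P v τ z * G z) :=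
    let hk := hτ.cutoffKernel_mul hG.continuous
    hk.1.integrable_of_hasCompactSupport hk.2
  refine integral_eq_of_combination hA hB hC hK ?_
  filter_upwards [ae_ne_zero hm] with z hz
  have hz' : ‖z‖ ^ 2 ≠ 0 := by simpa using hz
  have e1 : ∑ j, (∑ i, symb a b P v j i z * pd (pd G j) i z +
      (m * zsymb a b P v j z - (m - a * c) * (z j * ev P (reflVec v z))) / ‖z‖ ^ 2 * pd G j z) =
      ∑ j, ∑ i, symb a b P v j i z * pd (pd G j) i z +
      (m * ∑ j, zsymb a b P v j z * pd G j z -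
        (m - a * c) * ∑ j, z j * ev P (reflVec v z) * pd G j z) / ‖z‖ ^ 2 := by
    rw [Finset.sum_add_distrib, Finset.mul_sum, Finset.mul_sum, ← Finset.sum_sub_distrib,
      Finset.sum_div]
    congr 1
    exact Finset.sum_congr rfl fun j _ => by ring
  rw [e1, cutoffKernel]
  field_simp
  ring

end IntegrationByParts

end

section
open scoped ContDiff Topology

lemma integral_linear_combination {α : Type*} [MeasurableSpace α] {μ : Measure α}
    {f g h : α → ℝ} (hf : Integrable f μ) (hg : Integrable g μ) (hh : Integrable h μ)
    (a b c : ℝ) :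
    ∫ x, (a * f x + b * g x + c * h x) ∂μ =
      a * ∫ x, f x ∂μ + b * ∫ x, g x ∂μ + c * ∫ x, h x ∂μ := by
  have h1 := integral_add' ((hf.const_mul a).add (hg.const_mul b)) (hh.const_mul c)
  rw [integral_add' (hf.const_mul a) (hg.const_mul b)] at h1
  simpa [integral_const_mul] using h1

section KernelIntegral

open MvPolynomial (pderiv)

variable {m : ℕ} {v : Eu m} {P : MvPolynomial (Fin m) ℝ} {a b c : ℝ} {τ : ℝ → ℝ}

lemma RadialWeight.integrable_ev (hτ : RadialWeight τ) :
    Integrable (fun z => τ (‖z‖ ^ 2) * ev P (reflVec v z)) :=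
  hτ.integrable fun _ hz => (contDiffAt_ev (n := 0) hz).continuousAt

lemma RadialWeight.integrable_refInner_nd (hτ : RadialWeight τ) :
    Integrable (fun z => τ (‖z‖ ^ 2) * (refInner v z * nd P v z)) :=
  hτ.integrable fun _ hz =>
    ((contDiffAt_refInner (n := 0)).mul (contDiffAt_nd (n := 0) hz)).continuousAt

lemma RadialWeight.integrable_nd2 (hτ : RadialWeight τ) :
    Integrable (fun z => τ (‖z‖ ^ 2) * nd2 P v z) :=
  hτ.integrable fun _ hz => (contDiffAt_nd2 (n := 0) hz).continuousAt

lemma HarmEuler.integral_relations (h : HarmEuler P c) (hm : 0 < m) (hτ : RadialWeight τ) :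
    c * (∫ z, τ (‖z‖ ^ 2) * ev P (reflVec v z)) +
      (m + 2 * c - 4) * (∫ z, (‖z‖ ^ 2)⁻¹ * τ (‖z‖ ^ 2) * (refInner v z * nd P v z)) = 0 ∧
    ‖v‖ ^ 2 * (∫ z, (‖z‖ ^ 2)⁻¹ * τ (‖z‖ ^ 2) * nd2 P v z) = 0 := by
  have D1 := (hτ.integral_divergence hm (fun x _ => hτ.hasDerivAt x)
    (h := fun i z => refInner v z * ev (pderiv i P) (reflVec v z))
    (N := fun z => refInner v z * nd P v z)
    (fun z hz i => (contDiffAt_refInner (n := 1)).mul (contDiffAt_ev (n := 1) hz))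
    (fun z hz => h.hasDiv_refInner_mul_grad hz)
    (fun z hz => by
      rw [← sum_mul_ev, Finset.mul_sum]
      exact Finset.sum_congr rfl fun i _ => by ring)).2
  have D2 := (hτ.inv_mul.integral_divergence hm
    (fun x hx => (hasDerivAt_inv hx.ne').mul (hτ.hasDerivAt x))
    (h := fun i z => z i * (refInner v z * nd P v z))
    (N := fun z => ‖z‖ ^ 2 * (refInner v z * nd P v z))
    (fun z hz i => (contDiffAt_coord (n := 1) i).mul
      ((contDiffAt_refInner (n := 1)).mul (contDiffAt_nd (n := 1) hz)))
    (fun z hz => hasDiv_coord_mul_refInner_nd hz)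
    (fun z hz => by
      rw [← sum_sq_eq, Finset.sum_mul]
      exact Finset.sum_congr rfl fun i _ => by ring)).2
  have D3 := (hτ.integral_divergence hm (fun x _ => hτ.hasDerivAt x)
    (h := fun i z => reflVec v z i * nd P v z)
    (N := fun z => refInner v z * nd P v z)
    (fun z hz i => (contDiffAt_reflVec_apply (n := 1) hz i).mul (contDiffAt_nd (n := 1) hz))
    (fun z hz => h.hasDiv_reflVec_mul_nd hz)
    (fun z hz => by
      rw [← sum_reflVec_mul hz, Finset.sum_mul]
      exact Finset.sum_congr rfl fun i _ => by ring)).2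
  have i1 := hτ.integrable_ev (P := P) (v := v)
  have i2 := hτ.inv_mul.integrable_refInner_nd (P := P) (v := v)
  have i3 := hτ.inv_mul.integrable_nd2 (P := P) (v := v)
  have i4 := hτ.deriv.integrable_refInner_nd (P := P) (v := v)
  have E1 : 2 * (∫ z, deriv τ (‖z‖ ^ 2) * (refInner v z * nd P v z)) +
      (-c) * (∫ z, τ (‖z‖ ^ 2) * ev P (reflVec v z)) +
      (4 - 2 * c) * (∫ z, (‖z‖ ^ 2)⁻¹ * τ (‖z‖ ^ 2) * (refInner v z * nd P v z)) = 0 := by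
    rw [← integral_linear_combination i4 i1 i2]
    refine (integral_congr_ae (Filter.Eventually.of_forall fun z => ?_)).trans D1
    ring
  have E2 : 2 * (∫ z, deriv τ (‖z‖ ^ 2) * (refInner v z * nd P v z)) +
      0 * (∫ z, τ (‖z‖ ^ 2) * ev P (reflVec v z)) +
      m * (∫ z, (‖z‖ ^ 2)⁻¹ * τ (‖z‖ ^ 2) * (refInner v z * nd P v z)) = 0 := by
    rw [← integral_linear_combination i4 i1 i2]
    refine (integral_congr_ae ?_).trans D2
    filter_upwards [ae_ne_zero hm] with z hz
    have hz' : ‖z‖ ^ 2 ≠ 0 := by simpa using hz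
    field_simp
    ring
  have E3 : 1 * (∫ z, (2 * (deriv τ (‖z‖ ^ 2) * (refInner v z * nd P v z)) +
      c * (τ (‖z‖ ^ 2) * ev P (reflVec v z)) +
      (2 * (m + c - 2)) * ((‖z‖ ^ 2)⁻¹ * τ (‖z‖ ^ 2) * (refInner v z * nd P v z)))) +
      (-2 * ‖v‖ ^ 2) * (∫ z, (‖z‖ ^ 2)⁻¹ * τ (‖z‖ ^ 2) * nd2 P v z) +
      0 * (∫ z, (‖z‖ ^ 2)⁻¹ * τ (‖z‖ ^ 2) * nd2 P v z) = 0 := by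
    refine (integral_linear_combination
      (((i4.const_mul 2).add (i1.const_mul c)).add (i2.const_mul (2 * (m + c - 2)))) i3 i3
      1 (-2 * ‖v‖ ^ 2) 0).symm.trans ?_
    refine (integral_congr_ae (Filter.Eventually.of_forall fun z => ?_)).trans D3
    simp only [Pi.add_apply]
    ring
  rw [integral_linear_combination i4 i1 i2] at E3
  have J1 : c * (∫ z, τ (‖z‖ ^ 2) * ev P (reflVec v z)) +
      (m + 2 * c - 4) * (∫ z, (‖z‖ ^ 2)⁻¹ * τ (‖z‖ ^ 2) * (refInner v z * nd P v z)) = 0 := by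
    linarith
  exact ⟨J1, by linarith⟩

/-- The average of a harmonic polynomial over the reflections of `v` in all directions. -/
theorem integral_ev_reflVec (hm : 4 < m) (hτ : RadialWeight τ) (n : ℕ)
    (hP : P.IsHomogeneous n) (hh : ∑ i, pderiv i (pderiv i P) = 0) :
    (m + 2 * n - 2) * (∫ z : Eu m, τ (‖z‖ ^ 2) * ev P (reflVec v z)) =
      (m - 2) * ev P v * (∫ z : Eu m, τ (‖z‖ ^ 2)) := by
  induction n generalizing P with
  | zero =>
    obtain ⟨r, rfl⟩ : ∃ r, P = MvPolynomial.C r :=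
      ⟨_, MvPolynomial.totalDegree_eq_zero_iff_eq_C.1
        ((MvPolynomial.totalDegree_zero_iff_isHomogeneous _).2 hP)⟩
    simp only [ev, MvPolynomial.eval_C, integral_mul_const]
    push_cast
    ring
  | succ n ih =>
    have h : HarmEuler P ((n + 1 : ℕ) : ℝ) := ⟨by simpa using hP.sum_X_mul_pderiv, hh⟩
    have hm' : (4 : ℝ) < m := by exact_mod_cast hm
    have ih' := fun i => ih (P := pderiv i P) hP.pderiv (h.partialDeriv i).harm
    have R := (h.integral_relations (v := v) (by omega) hτ).1
    have i1 := hτ.integrable_ev (P := P) (v := v)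
    have i2 := hτ.inv_mul.integrable_refInner_nd (P := P) (v := v)
    have E : ∑ i, v i * (∫ z : Eu m, τ (‖z‖ ^ 2) * ev (pderiv i P) (reflVec v z)) =
        ((n + 1 : ℕ) : ℝ) * (∫ z : Eu m, τ (‖z‖ ^ 2) * ev P (reflVec v z)) +
        (-2) * (∫ z, (‖z‖ ^ 2)⁻¹ * τ (‖z‖ ^ 2) * (refInner v z * nd P v z)) +
        0 * (∫ z, (‖z‖ ^ 2)⁻¹ * τ (‖z‖ ^ 2) * (refInner v z * nd P v z)) := by
      rw [← integral_linear_combination i1 i2 i2]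
      simp only [← integral_const_mul]
      rw [← integral_finsetSum _ fun i _ => (hτ.integrable_ev).const_mul _]
      refine integral_congr_ae (Filter.Eventually.of_forall fun z => ?_)
      have := h.sum_vec_ev (v := v) (z := z)
      simp only [mul_left_comm _ (τ _), ← Finset.mul_sum]
      rw [this]
      ring
    have S : (m + 2 * n - 2) *
        ∑ i, v i * (∫ z : Eu m, τ (‖z‖ ^ 2) * ev (pderiv i P) (reflVec v z)) =
        (m - 2) * (((n + 1 : ℕ) : ℝ) * ev P v) * (∫ z : Eu m, τ (‖z‖ ^ 2)) := by
      rw [← h.sum_ev v]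
      simp only [Finset.mul_sum, Finset.sum_mul]
      refine Finset.sum_congr rfl fun i _ => ?_
      linear_combination v i * ih' i
    rw [E] at S
    push_cast at S R ⊢
    have hn : (n : ℝ) + 1 ≠ 0 := by positivity
    apply mul_left_cancel₀ hn
    linear_combination S + 2 * R

/-- The total mass of the cut-off kernel. -/
theorem integral_cutoffKernel (hm : 4 < m) (hτ : RadialWeight τ) (n : ℕ)
    (hP : P.IsHomogeneous n) (hh : ∑ i, pderiv i (pderiv i P) = 0)
    (ha : a * (m + 2 * n - 2) = 4) (hb : a = b * (m + 2 * n - 4)) :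
    (m + 2 * n - 4) * (∫ z : Eu m, cutoffKernel a b n P v τ z) =
      -2 * (m - 2) * (m - 4) * ev P v * (∫ z : Eu m, τ (‖z‖ ^ 2)) := by
  have h : HarmEuler P (n : ℝ) := ⟨by simpa using hP.sum_X_mul_pderiv, hh⟩
  obtain ⟨R1, R2⟩ := h.integral_relations (v := v) (by omega) hτ
  have D := hτ.integral_divergence (by omega) (fun x _ => hτ.hasDerivAt x)
    (h := zsymb a b P v) (N := zzsymb a b P v)
    (fun z hz i => contDiffAt_zsymb (n := 1) hz i)
    (fun z hz => h.hasDiv_zsymb hz hb) (fun z hz => sum_mul_zsymb hz)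
  have i1 := hτ.integrable_ev (P := P) (v := v)
  have i2 := hτ.inv_mul.integrable_refInner_nd (P := P) (v := v)
  have i3 := hτ.inv_mul.integrable_nd2 (P := P) (v := v)
  have e := integral_linear_combination D.1
    (((i1.const_mul (4 - 2 * (m - a * n))).add (i2.const_mul (-4 * a))).add
      (i3.const_mul (4 * b * ‖v‖ ^ 2))) i3 2 1 0
  have hK : ∫ z : Eu m, cutoffKernel a b n P v τ z = (4 - 2 * (m - a * n)) *
      (∫ z, τ (‖z‖ ^ 2) * ev P (reflVec v z)) +
      (-4 * a) * (∫ z, (‖z‖ ^ 2)⁻¹ * τ (‖z‖ ^ 2) * (refInner v z * nd P v z)) +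
      (4 * b * ‖v‖ ^ 2) * (∫ z, (‖z‖ ^ 2)⁻¹ * τ (‖z‖ ^ 2) * nd2 P v z) := by
    rw [← integral_linear_combination i1 i2 i3]
    rw [D.2, mul_zero, zero_add, one_mul, zero_mul, add_zero] at e
    refine Eq.trans (integral_congr_ae ?_) e
    filter_upwards [ae_ne_zero (show 0 < m by omega)] with z hz
    have hz' : ‖z‖ ^ 2 ≠ 0 := by simpa using hz
    simp only [cutoffKernel, zzsymb, Pi.add_apply]
    field_simp
    ring
  have M := integral_ev_reflVec (v := v) hm hτ n hP hh
  rw [hK]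
  linear_combination -2 * (m - 4) * M + 4 * b * (m + 2 * n - 4) * R2 - 4 * a * R1 +
    2 * n * (∫ z, τ (‖z‖ ^ 2) * ev P (reflVec v z)) * ha

end KernelIntegral

end

section
open scoped ContDiff Topology

/-- The space of harmonic polynomials in `m` variables, homogeneous of degree `k`. -/
def harmPoly (m k : ℕ) : Submodule ℝ (MvPolynomial (Fin m) ℝ) where
  carrier := {P | P.IsHomogeneous k ∧ ∑ i, MvPolynomial.pderiv i (MvPolynomial.pderiv i P) = 0}
  add_mem' := fun {P Q} hP hQ => ⟨hP.1.add hQ.1, by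
    have h1 := hP.2
    have h2 := hQ.2
    simp [Finset.sum_add_distrib, h1, h2]⟩
  zero_mem' := ⟨MvPolynomial.isHomogeneous_zero _ _ _, by simp⟩
  smul_mem' := fun c P hP => ⟨(MvPolynomial.homogeneousSubmodule (Fin m) ℝ k).smul_mem c hP.1, by
    have h1 := hP.2
    simp [← Finset.smul_sum, h1]⟩

variable {m k : ℕ}

instance : Module.Finite ℝ (harmPoly m k) :=
  have : Module.Finite ℝ (MvPolynomial.homogeneousSubmodule (Fin m) ℝ k) :=
    Module.Finite.iff_fg.2 (MvPolynomial.homogeneousSubmodule_fg (Fin m) ℝ k)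
  Submodule.finiteDimensional_of_le
    (show harmPoly m k ≤ MvPolynomial.homogeneousSubmodule (Fin m) ℝ k from fun _ h => h.1)

lemma ev_add (P Q : MvPolynomial (Fin m) ℝ) (u : Eu m) : ev (P + Q) u = ev P u + ev Q u := by
  simp [ev]

lemma ev_smul (c : ℝ) (P : MvPolynomial (Fin m) ℝ) (u : Eu m) : ev (c • P) u = c * ev P u := by
  simp [ev]

lemma ev_sum {ι : Type*} (s : Finset ι) (P : ι → MvPolynomial (Fin m) ℝ) (u : Eu m) :
    ev (∑ l ∈ s, P l) u = ∑ l ∈ s, ev (P l) u := by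
  simp [ev]

lemma ev_injective {P Q : MvPolynomial (Fin m) ℝ} (h : ∀ u, ev P u = ev Q u) : P = Q :=
  MvPolynomial.funext fun x => h (WithLp.toLp 2 x)

lemma MvPolynomial.IsHomogeneous.sum_eq {P : MvPolynomial (Fin m) ℝ} (hP : P.IsHomogeneous k)
    {d : Fin m →₀ ℕ} (hd : d ∈ P.support) : ∑ i, d i = k := by
  rw [← hP (MvPolynomial.mem_support_iff.1 hd), ← Finsupp.degree_eq_sum,
    Finsupp.degree_eq_weight_one]
  rfl

lemma MvPolynomial.IsHomogeneous.ev_smul_vec {P : MvPolynomial (Fin m) ℝ} (hP : P.IsHomogeneous k)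
    (t : ℝ) (u : Eu m) : ev P (t • u) = t ^ k * ev P u := by
  rw [ev, ev, MvPolynomial.eval_eq', MvPolynomial.eval_eq', Finset.mul_sum]
  refine Finset.sum_congr rfl fun d hd => ?_
  rw [← hP.sum_eq hd]
  simp only [PiLp.smul_apply, smul_eq_mul, mul_pow, Finset.prod_mul_distrib,
    Finset.prod_pow_eq_pow_sum]
  ring

/-- Reproducing formula for homogeneous harmonic polynomials from finitely many values in the
unit ball. -/
lemma exists_interpolation (m k : ℕ) : ∃ (s : Finset {u : Eu m // ‖u‖ < 1})
    (q : {u : Eu m // ‖u‖ < 1} → MvPolynomial (Fin m) ℝ), (∀ l, q l ∈ harmPoly m k) ∧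
      ∀ P ∈ harmPoly m k, P = ∑ l ∈ s, ev P l • q l := by
  classical
  let e : {u : Eu m // ‖u‖ < 1} → Module.Dual ℝ (harmPoly m k) := fun u =>
    { toFun := fun P => ev P.1 u
      map_add' := fun P Q => ev_add _ _ _
      map_smul' := fun c P => ev_smul _ _ _ }
  have hco : (Submodule.span ℝ (Set.range e)).dualCoannihilator = ⊥ := by
    rw [eq_bot_iff]
    intro P hP
    have hP' : ∀ u : {u : Eu m // ‖u‖ < 1}, ev P.1 u = 0 := fun u =>
      (Submodule.mem_dualCoannihilator P).1 hP (e u) (Submodule.subset_span ⟨u, rfl⟩)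
    have : P.1 = 0 := ev_injective fun u => by
      have hpos : 0 < ‖u‖ + 1 := by positivity
      have h1 : ‖(‖u‖ + 1)⁻¹ • u‖ < 1 := by
        rw [norm_smul, norm_inv, Real.norm_of_nonneg hpos.le, inv_mul_lt_iff₀ hpos]
        linarith
      have h2 := hP' ⟨_, h1⟩
      rw [show ev P.1 ((‖u‖ + 1)⁻¹ • u) = _ from P.2.1.ev_smul_vec _ _] at h2
      have h3 := (mul_eq_zero.1 h2).resolve_left (by positivity)
      simpa [ev] using h3
    exact Subtype.ext this
  have htop : Submodule.span ℝ (Set.range e) = ⊤ := by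
    rw [← Subspace.dualCoannihilator_dualAnnihilator_eq (W := Submodule.span ℝ (Set.range e)), hco]
    simp
  let b := Module.finBasis ℝ (harmPoly m k)
  have hb : ∀ i, ∃ a : {u : Eu m // ‖u‖ < 1} →₀ ℝ, (a.sum fun u t => t • e u) = b.coord i := by
    intro i
    exact (Finsupp.mem_span_range_iff_exists_finsupp).1 (htop ▸ Submodule.mem_top)
  choose a ha using hb
  refine ⟨Finset.univ.biUnion fun i => (a i).support,
    fun u => ∑ i, a i u • (b i).1, fun l => ?_, fun P hP => ?_⟩
  · exact Submodule.sum_mem _ fun i _ => Submodule.smul_mem _ _ (b i).2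
  · have h1 := congrArg Subtype.val (b.sum_repr ⟨P, hP⟩)
    rw [AddSubmonoidClass.coe_finsetSum] at h1
    refine h1.symm.trans ?_
    simp only [Finset.smul_sum]
    rw [Finset.sum_comm]
    refine Finset.sum_congr rfl fun i _ => ?_
    have h2 : b.repr ⟨P, hP⟩ i = ∑ u ∈ Finset.univ.biUnion fun i => (a i).support,
        a i u * ev P u := by
      have h3 := LinearMap.congr_fun (ha i) ⟨P, hP⟩
      rw [Finsupp.sum_of_support_subset (a i)
        (Finset.subset_biUnion_of_mem (fun i => (a i).support) (Finset.mem_univ i)) _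
          (by simp)] at h3
      rw [← b.coord_apply, ← h3, LinearMap.sum_apply]
      rfl
    rw [Submodule.coe_smul, h2, Finset.sum_smul]
    exact Finset.sum_congr rfl fun u _ => by rw [smul_smul, mul_comm]

lemma pd_pd_ev (P : MvPolynomial (Fin m) ℝ) (i j : Fin m) :
    pd (pd (ev P) i) j = ev (MvPolynomial.pderiv j (MvPolynomial.pderiv i P)) := by
  rw [pd_ev, pd_ev]

/-- Homogeneous harmonic polynomial functions are the evaluations of elements of `harmPoly`. -/
lemma isHarmPolyHom_iff {p : Eu m → ℝ} :
    IsHarmPolyHom m k p ↔ ∃ P ∈ harmPoly m k, p = ev P := by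
  classical
  constructor
  · rintro ⟨⟨s, c, hs, hp⟩, hh⟩
    set P : MvPolynomial (Fin m) ℝ :=
      ∑ α ∈ s, MvPolynomial.monomial (Finsupp.equivFunOnFinite.symm α) (c α) with hP
    have hpP : p = ev P := by
      funext u
      rw [hp, hP, ev_sum]
      refine Finset.sum_congr rfl fun α _ => ?_
      simp [ev, MvPolynomial.eval_monomial, Finsupp.prod_fintype]
    refine ⟨P, ⟨?_, ?_⟩, hpP⟩
    · refine MvPolynomial.IsHomogeneous.sum _ _ _ fun α hα => ?_
      refine MvPolynomial.isHomogeneous_monomial _ ?_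
      rw [Finsupp.degree_eq_sum]
      simpa using hs α hα
    · refine ev_injective fun u => ?_
      have := hh u
      simp only [hpP, pd_pd_ev] at this
      rw [ev_sum, this]
      simp [ev]
  · rintro ⟨P, ⟨hP, hh⟩, rfl⟩
    refine ⟨⟨P.support.map Finsupp.equivFunOnFinite.toEmbedding,
      fun α => P.coeff (Finsupp.equivFunOnFinite.symm α), ?_, ?_⟩, ?_⟩
    · intro α hα
      obtain ⟨d, hd, rfl⟩ := Finset.mem_map.1 hα
      exact hP.sum_eq hd
    · intro u
      rw [Finset.sum_map, ev, MvPolynomial.eval_eq']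
      simp
    · intro u
      simp only [pd_pd_ev]
      rw [← ev_sum, hh]
      simp [ev]

namespace ValuesInHk

variable {R : (Eu m → ℝ) → Prop} {f : Eu m → Eu m → ℝ}

lemma isHarmPolyHom (h : ValuesInHk m k R f) (x : Eu m) : IsHarmPolyHom m k (f x) := by
  obtain ⟨⟨s, c, hs, -, hf⟩, hh⟩ := h
  exact ⟨⟨s, fun α => c α x, hs, fun u => hf x u⟩, fun u => hh x u⟩

lemma contDiff {n : WithTop ℕ∞} (h : ValuesInHk m k (fun c => ContDiff ℝ n c) f) (u : Eu m) :
    ContDiff ℝ n fun x => f x u := by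
  obtain ⟨⟨s, c, -, hc, hf⟩, -⟩ := h
  simp only [hf]
  exact ContDiff.sum fun α hα => (hc α hα).mul contDiff_const

lemma eq_sum {s : Finset {u : Eu m // ‖u‖ < 1}}
    {q : {u : Eu m // ‖u‖ < 1} → MvPolynomial (Fin m) ℝ}
    (hq : ∀ P ∈ harmPoly m k, P = ∑ l ∈ s, ev P l • q l)
    (h : ValuesInHk m k R f) (x u : Eu m) : f x u = ∑ l ∈ s, f x l * ev (q l) u := by
  obtain ⟨P, hP, hf⟩ := isHarmPolyHom_iff.1 (h.isHarmPolyHom x)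
  rw [hf]
  conv_lhs => rw [hq P hP, ev_sum]
  simp [ev_smul]

end ValuesInHk

end

section
open scoped ContDiff Topology

lemma pd_pd_comm {m : ℕ} {G : Eu m → ℝ} (hG : ContDiff ℝ 2 G) (i j : Fin m) (x : Eu m) :
    pd (pd G i) j x = pd (pd G j) i x := by
  have hd : DifferentiableAt ℝ (fderiv ℝ G) x :=
    (hG.fderiv_right (m := 1) (by norm_num)).differentiable (by simp) x
  have key : ∀ i j, pd (pd G i) j x =
      fderiv ℝ (fderiv ℝ G) x (EuclideanSpace.single j 1) (EuclideanSpace.single i 1) := by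
    intro i j
    change fderiv ℝ (fun y => fderiv ℝ G y (EuclideanSpace.single i 1)) x _ = _
    rw [fderiv_clm_apply hd (by fun_prop)]
    simp
  rw [key, key]
  exact (hG.contDiffAt.isSymmSndFDerivAt (by simp)).eq _ _

lemma contDiff_pd {m : ℕ} {G : Eu m → ℝ} (hG : ContDiff ℝ 2 G) (i : Fin m) :
    ContDiff ℝ 1 (pd G i) :=
  (hG.fderiv_right (m := 1) (by norm_num)).clm_apply contDiff_const

section Expansion

variable {m k : ℕ} {ι : Type*} {s : Finset ι} {c : ι → Eu m → ℝ}
  {q : ι → MvPolynomial (Fin m) ℝ}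

lemma pdx_sum (hc : ∀ l ∈ s, Differentiable ℝ (c l)) (i : Fin m) :
    pdx (fun x u => ∑ l ∈ s, c l x * ev (q l) u) i =
      fun x u => ∑ l ∈ s, pd (c l) i x * ev (q l) u := by
  funext x u
  have h := HasPD.sum s fun l hl =>
    (HasPD.of_differentiableAt (hc l hl x)).mul (HasPD.const (ev (q l) u))
  exact (h.pd_eq i).trans (by simp)

lemma pdu_sum (i : Fin m) :
    pdu (fun x u => ∑ l ∈ s, c l x * ev (q l) u) i =
      fun x u => ∑ l ∈ s, c l x * ev (MvPolynomial.pderiv i (q l)) u := by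
  funext x u
  have h := HasPD.sum s fun l _ => (HasPD.ev_id (q l) u).const_mul (c l x)
  exact (h.pd_eq i).trans (by simp)

lemma bosonicLaplacian_sum (hc : ∀ l ∈ s, ContDiff ℝ 2 (c l)) {a b : ℝ}
    (ha : a = 4 / ((m : ℝ) + 2 * k - 2))
    (hb : b = 4 / (((m : ℝ) + 2 * k - 2) * ((m : ℝ) + 2 * k - 4))) (x w : Eu m) :
    bosonicLaplacian m k (fun x u => ∑ l ∈ s, c l x * ev (q l) u) x w =
      ∑ l ∈ s, ∑ j, ∑ i, ((if i = j then ev (q l) w else 0) -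
        a / 2 * (w i * ev (MvPolynomial.pderiv j (q l)) w +
          w j * ev (MvPolynomial.pderiv i (q l)) w) +
        b * ‖w‖ ^ 2 * ev (MvPolynomial.pderiv i (MvPolynomial.pderiv j (q l))) w) *
          pd (pd (c l) j) i x := by
  have h1 : ∀ l ∈ s, Differentiable ℝ (c l) := fun l hl => (hc l hl).differentiable (by simp)
  have h2 : ∀ j, ∀ l ∈ s, Differentiable ℝ (pd (c l) j) := fun j l hl =>
    (contDiff_pd (hc l hl) j).differentiable (by simp)
  unfold bosonicLaplacian
  simp only [pdx_sum h1, pdx_sum (h2 _), pdu_sum]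
  rw [show 4 * ‖w‖ ^ 2 / (((m : ℝ) + 2 * k - 2) * ((m : ℝ) + 2 * k - 4)) = b * ‖w‖ ^ 2 by
    rw [hb]; ring, ← ha]
  have e1 : ∀ F : Fin m → Fin m → ι → ℝ,
      ∑ i, ∑ j, ∑ l ∈ s, F i j l = ∑ l ∈ s, ∑ i, ∑ j, F i j l := fun F =>
    (Finset.sum_congr rfl fun i _ => Finset.sum_comm).trans Finset.sum_comm
  have e2 : ∀ t : ℝ, ∀ F : Fin m → Fin m → ι → ℝ,
      t * ∑ i, ∑ j, ∑ l ∈ s, F i j l = ∑ l ∈ s, t * ∑ i, ∑ j, F i j l := fun t F => by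
    rw [e1, Finset.mul_sum]
  rw [Finset.sum_comm, show (∑ i, ∑ j, w i * ∑ l ∈ s,
      pd (pd (c l) j) i x * ev (MvPolynomial.pderiv j (q l)) w) =
    ∑ i, ∑ j, ∑ l ∈ s, w i * (pd (pd (c l) j) i x * ev (MvPolynomial.pderiv j (q l)) w) by
      simp only [Finset.mul_sum], e2, e2, ← Finset.sum_sub_distrib, ← Finset.sum_add_distrib]
  refine Finset.sum_congr rfl fun l hl => ?_
  have e3 : ∑ j, ∑ i, (if i = j then ev (q l) w else 0) * pd (pd (c l) j) i x =
      ∑ i, pd (pd (c l) i) i x * ev (q l) w := by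
    refine Finset.sum_congr rfl fun j _ => ?_
    simp [mul_comm]
  have e4 : ∑ j, ∑ i, w i * ev (MvPolynomial.pderiv j (q l)) w * pd (pd (c l) j) i x =
      ∑ i, ∑ j, w i * (pd (pd (c l) j) i x * ev (MvPolynomial.pderiv j (q l)) w) := by
    rw [Finset.sum_comm]
    exact Finset.sum_congr rfl fun i _ => Finset.sum_congr rfl fun j _ => by ring
  have e5 : ∑ j, ∑ i, w j * ev (MvPolynomial.pderiv i (q l)) w * pd (pd (c l) j) i x =
      ∑ i, ∑ j, w i * (pd (pd (c l) j) i x * ev (MvPolynomial.pderiv j (q l)) w) :=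
    Finset.sum_congr rfl fun i _ => Finset.sum_congr rfl fun j _ => by
      rw [pd_pd_comm (hc l hl)]; ring
  have e6 : ∑ j, ∑ i, ev (MvPolynomial.pderiv i (MvPolynomial.pderiv j (q l))) w *
      pd (pd (c l) j) i x = ∑ i, ∑ j, pd (pd (c l) j) i x *
        ev (MvPolynomial.pderiv i (MvPolynomial.pderiv j (q l))) w := by
    rw [Finset.sum_comm]
    exact Finset.sum_congr rfl fun i _ => Finset.sum_congr rfl fun j _ => mul_comm _ _
  rw [← e6, ← e3]
  have e7 := congrArg₂ (fun S T => a / 2 * (S + T)) e4 e5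
  simp only at e7
  rw [show ∀ S : ℝ, a * S = a / 2 * (S + S) from fun S => by ring, ← e7]
  simp only [← Finset.sum_add_distrib, Finset.mul_sum, ← Finset.sum_sub_distrib]
  exact Finset.sum_congr rfl fun i _ => Finset.sum_congr rfl fun j _ => by ring

end Expansion

end

section
open scoped ContDiff Topology

/-- A smooth antitone function equal to `1` on `(-∞, 1]` and to `0` on `[4, ∞)`. -/
def stepDown (x : ℝ) : ℝ := Real.smoothTransition ((4 - x) / 3)

lemma contDiff_stepDown : ContDiff ℝ ∞ stepDown :=
  Real.smoothTransition.contDiff.comp (by fun_prop)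

lemma stepDown_of_le {x : ℝ} (h : x ≤ 1) : stepDown x = 1 :=
  Real.smoothTransition.one_of_one_le (by linarith)

lemma stepDown_of_ge {x : ℝ} (h : 4 ≤ x) : stepDown x = 0 :=
  Real.smoothTransition.zero_of_nonpos (by linarith)

lemma stepDown_mem (x : ℝ) : 0 ≤ stepDown x ∧ stepDown x ≤ 1 :=
  ⟨Real.smoothTransition.nonneg _, Real.smoothTransition.le_one _⟩

lemma antitone_stepDown : Antitone stepDown := fun x y h =>
  Real.smoothTransition.monotone (by linarith)

lemma hasDerivAt_stepDown (x : ℝ) : HasDerivAt stepDown (deriv stepDown x) x :=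
  (contDiff_stepDown.differentiable (by simp) x).hasDerivAt

lemma deriv_stepDown_nonpos (x : ℝ) : deriv stepDown x ≤ 0 :=
  antitone_stepDown.deriv_nonpos

lemma exists_deriv_stepDown_ne_zero : ∃ x > 0, deriv stepDown x ≠ 0 := by
  obtain ⟨x, hx, h⟩ := exists_deriv_eq_slope stepDown (by norm_num : (1 : ℝ) < 4)
    contDiff_stepDown.continuous.continuousOn
    (contDiff_stepDown.differentiable (by simp)).differentiableOn
  refine ⟨x, by linarith [hx.1], ?_⟩
  rw [h, stepDown_of_le le_rfl, stepDown_of_ge le_rfl]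
  norm_num

lemma radialWeight_deriv_stepDown : RadialWeight (deriv stepDown) where
  smooth := contDiff_stepDown.iterate_deriv 1
  vanish := by
    refine ⟨1 / 2, 5, by norm_num, fun x hx => ?_⟩
    rcases hx with hx | hx
    · have : stepDown =ᶠ[𝓝 x] fun _ => 1 := by
        filter_upwards [Iio_mem_nhds (show x < 1 by linarith)] with y hy using stepDown_of_le hy.le
      rw [this.deriv_eq, deriv_const]
    · have : stepDown =ᶠ[𝓝 x] fun _ => 0 := by
        filter_upwards [Ioi_mem_nhds (show 4 < x by linarith)] with y hy using stepDown_of_ge hy.le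
      rw [this.deriv_eq, deriv_const]

lemma RadialWeight.comp_div {T : ℝ → ℝ} (hT : RadialWeight T) {r : ℝ} (hr : 0 < r) :
    RadialWeight (fun x => T (x / r)) where
  smooth := hT.smooth.comp (by fun_prop)
  vanish := by
    obtain ⟨α, β, hα, h⟩ := hT.vanish
    refine ⟨α * r, β * r, by positivity, fun x hx => h _ ?_⟩
    rw [div_le_iff₀ hr, le_div_iff₀ hr]
    exact hx

/-- The difference of the fundamental radial profile `x ^ (1 - m / 2)` cut off at radii
`√R` and `√r`. -/
def annulusWeight (m : ℕ) (r R x : ℝ) : ℝ :=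
  x ^ (1 - (m : ℝ) / 2) * (stepDown (x / R) - stepDown (x / r))

/-- The profile of the boundary term produced by `annulusWeight`. -/
def boundaryWeight (m : ℕ) (x : ℝ) : ℝ := x ^ (1 - (m : ℝ) / 2) * deriv stepDown x

variable {m : ℕ}

lemma radialWeight_boundaryWeight : RadialWeight (boundaryWeight m) :=
  radialWeight_deriv_stepDown.rpow_mul _

lemma radialWeight_annulusWeight {r R : ℝ} (hr : 0 < r) (hrR : r ≤ R) :
    RadialWeight (annulusWeight m r R) := by
  have hR : 0 < R := hr.trans_le hrR
  refine RadialWeight.rpow_mul (T := fun x => stepDown (x / R) - stepDown (x / r)) ⟨?_, ?_⟩ _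
  · exact (contDiff_stepDown.comp (by fun_prop)).sub (contDiff_stepDown.comp (by fun_prop))
  · refine ⟨r, 4 * R, hr, fun x hx => ?_⟩
    rcases hx with hx | hx
    · rw [stepDown_of_le ((div_le_one hR).2 (hx.trans hrR)), stepDown_of_le ((div_le_one hr).2 hx),
        sub_self]
    · rw [stepDown_of_ge ((le_div_iff₀ hR).2 hx),
        stepDown_of_ge ((le_div_iff₀ hr).2 (by linarith)), sub_self]

lemma boundaryWeight_div {r x : ℝ} (hr : 0 < r) (hx : 0 < x) :
    r⁻¹ ^ ((m : ℝ) / 2) * boundaryWeight m (x / r) =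
      x ^ (1 - (m : ℝ) / 2) * (deriv stepDown (x / r) / r) := by
  have h : r⁻¹ ^ ((m : ℝ) / 2) * (x / r) ^ (1 - (m : ℝ) / 2) = x ^ (1 - (m : ℝ) / 2) / r := by
    rw [Real.div_rpow hx.le hr.le, Real.inv_rpow hr.le, Real.rpow_sub hr, Real.rpow_one]
    have := (Real.rpow_pos_of_pos hr ((m : ℝ) / 2)).ne'
    field_simp
  unfold boundaryWeight
  rw [← mul_assoc, h]
  ring

lemma hasDerivAt_annulusWeight {r R x : ℝ} (hr : 0 < r) (hR : 0 < R) (hx : 0 < x) :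
    HasDerivAt (annulusWeight m r R) ((1 - m / 2) * (x⁻¹ * annulusWeight m r R x) +
      (R⁻¹ ^ ((m : ℝ) / 2) * boundaryWeight m (x / R) +
        -1 * (r⁻¹ ^ ((m : ℝ) / 2) * boundaryWeight m (x / r)))) x := by
  have h1 := Real.hasDerivAt_rpow_const (p := 1 - (m : ℝ) / 2) (Or.inl hx.ne')
  have h2 : ∀ t, HasDerivAt (fun x => stepDown (x / t)) (deriv stepDown (x / t) / t) x := by
    intro t
    simpa [Function.comp_def, div_eq_mul_inv] using
      (hasDerivAt_stepDown (x / t)).comp x ((hasDerivAt_id x).div_const t)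
  refine (h1.mul ((h2 R).sub (h2 r))).congr_deriv ?_
  rw [boundaryWeight_div hr hx, boundaryWeight_div hR hx, Real.rpow_sub_one hx.ne', annulusWeight]
  simp only [Pi.sub_apply]
  field_simp
  ring

lemma integral_boundaryWeight_ne_zero (hm : 0 < m) :
    (∫ z : Eu m, boundaryWeight m (‖z‖ ^ 2)) ≠ 0 := by
  obtain ⟨x, hx, h⟩ := exists_deriv_stepDown_ne_zero
  have hw := radialWeight_boundaryWeight (m := m)
  have hc : Continuous fun z : Eu m => -boundaryWeight m (‖z‖ ^ 2) := by
    simpa using hw.continuous (F := fun _ : Eu m => -1) fun _ _ => continuousAt_const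
  have hs : HasCompactSupport fun z : Eu m => -boundaryWeight m (‖z‖ ^ 2) := by
    simpa using (hw.hasCompactSupport (fun _ : Eu m => -1))
  have hpos := hc.integral_pos_of_hasCompactSupport_nonneg_nonzero (μ := volume) hs
    (fun z => neg_nonneg.2 (mul_nonpos_of_nonneg_of_nonpos (by positivity)
      (deriv_stepDown_nonpos _)))
    (x := EuclideanSpace.single ⟨0, hm⟩ √x) (by
      simp only [PiLp.norm_single, Real.norm_eq_abs, sq_abs, Real.sq_sqrt hx.le, neg_ne_zero]
      exact mul_ne_zero (Real.rpow_pos_of_pos hx _).ne' h)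
  rw [integral_neg] at hpos
  exact fun h0 => by simp [h0] at hpos

lemma abs_annulusWeight_le {r R x : ℝ} (hx : 0 ≤ x) :
    |annulusWeight m r R x| ≤ x ^ (1 - (m : ℝ) / 2) := by
  rw [annulusWeight, abs_mul, abs_of_nonneg (Real.rpow_nonneg hx _)]
  refine mul_le_of_le_one_right (Real.rpow_nonneg hx _) ?_
  have h1 := stepDown_mem (x / R)
  have h2 := stepDown_mem (x / r)
  rw [abs_le]
  constructor <;> linarith

lemma annulusWeight_eq {r R x : ℝ} (hr : 0 < r) (hR : 0 < R) (h1 : 4 * r ≤ x) (h2 : x ≤ R) :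
    annulusWeight m r R x = x ^ (1 - (m : ℝ) / 2) := by
  rw [annulusWeight, stepDown_of_le ((div_le_one hR).2 h2), stepDown_of_ge ((le_div_iff₀ hr).2 h1)]
  ring

end

section
open scoped ContDiff Topology

section CutoffKernel

variable {m : ℕ} {v z : Eu m} {P : MvPolynomial (Fin m) ℝ} {a b c : ℝ} {τ τ' : ℝ → ℝ}

lemma reflVec_smul {r : ℝ} (hr : r ≠ 0) (v z : Eu m) : reflVec v (r • z) = reflVec v z := by
  unfold reflVec
  rw [smul_smul, inner_smul_right, norm_smul, mul_pow, Real.norm_eq_abs, sq_abs]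
  congr 2
  by_cases hz : ‖z‖ ^ 2 = 0
  · simp [hz]
  · field_simp

lemma zzsymb_smul {r : ℝ} (hr : r ≠ 0) : zzsymb a b P v (r • z) = r ^ 2 * zzsymb a b P v z := by
  have h1 : ∀ Q, nd Q v (r • z) = r * nd Q v z := fun Q => by
    simp [nd, reflVec_smul hr, Finset.mul_sum, mul_assoc]
  have h2 : nd2 P v (r • z) = r ^ 2 * nd2 P v z := by
    simp only [nd2, h1, Finset.mul_sum, PiLp.smul_apply, smul_eq_mul]
    exact Finset.sum_congr rfl fun i _ => by ring
  have h3 : refInner v (r • z) = r * refInner v z := by simp [refInner, inner_smul_right]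
  rw [zzsymb, zzsymb, h1, h2, h3, reflVec_smul hr, norm_smul, mul_pow, Real.norm_eq_abs, sq_abs]
  ring

lemma cutoffKernel_add (h : Differentiable ℝ τ) (h' : Differentiable ℝ τ') :
    cutoffKernel a b c P v (fun x => τ x + τ' x) z =
      cutoffKernel a b c P v τ z + cutoffKernel a b c P v τ' z := by
  unfold cutoffKernel
  rw [deriv_fun_add (h _) (h' _)]
  ring

lemma cutoffKernel_const_mul (t : ℝ) :
    cutoffKernel a b c P v (fun x => t * τ x) z = t * cutoffKernel a b c P v τ z := by
  unfold cutoffKernel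
  rw [deriv_const_mul_field]
  ring

lemma cutoffKernel_smul {r : ℝ} (hr : 0 < r) (h : Differentiable ℝ τ) :
    cutoffKernel a b c P v (fun x => τ (x / r ^ 2)) (r • z) = cutoffKernel a b c P v τ z := by
  have hn : ‖r • z‖ ^ 2 = r ^ 2 * ‖z‖ ^ 2 := by
    rw [norm_smul, mul_pow, Real.norm_eq_abs, sq_abs]
  have hn' : ‖r • z‖ ^ 2 / r ^ 2 = ‖z‖ ^ 2 := by
    rw [hn]
    field_simp
  have hd : HasDerivAt (fun x => τ (x / r ^ 2)) (deriv τ (‖z‖ ^ 2) / r ^ 2) (‖r • z‖ ^ 2) := by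
    have := (h (‖r • z‖ ^ 2 / r ^ 2)).hasDerivAt.comp (‖r • z‖ ^ 2)
      ((hasDerivAt_id (‖r • z‖ ^ 2)).div_const (r ^ 2))
    rw [hn'] at this
    simpa [Function.comp_def, div_eq_mul_inv] using this
  unfold cutoffKernel
  simp only [hn']
  rw [hd.deriv, hn, zzsymb_smul hr.ne', reflVec_smul hr.ne']
  by_cases hz : ‖z‖ ^ 2 = 0
  · simp only [hz]
    field_simp
  · field_simp

lemma integral_cutoffKernel_rescale {r : ℝ} (hr : 0 < r) (h : Differentiable ℝ τ) (G : Eu m → ℝ) :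
    ∫ z : Eu m,
        cutoffKernel a b c P v (fun x => (r ^ 2)⁻¹ ^ ((m : ℝ) / 2) * τ (x / r ^ 2)) z * G z =
      ∫ z : Eu m, cutoffKernel a b c P v τ z * G (r • z) := by
  have e := Measure.integral_comp_smul_of_nonneg (volume : Measure (Eu m))
    (fun z => cutoffKernel a b c P v (fun x => τ (x / r ^ 2)) z * G z) r (hR := hr.le)
  simp only [cutoffKernel_smul hr h] at e
  simp only [cutoffKernel_const_mul, mul_assoc]
  rw [integral_const_mul, e, smul_eq_mul, finrank_euclideanSpace_fin]
  congr 1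
  rw [Real.inv_rpow (by positivity), ← Real.rpow_natCast r 2, ← Real.rpow_mul hr.le,
    ← Real.rpow_natCast]
  congr 2
  push_cast
  ring

/-- Green's formula for the fundamental solution over a smoothed annulus. -/
theorem HarmEuler.integral_annulusWeight (h : HarmEuler P c) (hm : 0 < m)
    (ha : a * (m + 2 * c - 2) = 4) (hb : a = b * (m + 2 * c - 4)) {r R : ℝ} (hr : 0 < r)
    (hrR : r ≤ R) {G : Eu m → ℝ} (hG : ContDiff ℝ 2 G) :
    ∫ z : Eu m, annulusWeight m (r ^ 2) (R ^ 2) (‖z‖ ^ 2) *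
        ∑ j, ∑ i, symb a b P v j i z * pd (pd G j) i z =
      (∫ z : Eu m, cutoffKernel a b c P v (boundaryWeight m) z * G (R • z)) -
        ∫ z : Eu m, cutoffKernel a b c P v (boundaryWeight m) z * G (r • z) := by
  have hR : 0 < R := hr.trans_le hrR
  have hw := radialWeight_boundaryWeight (m := m)
  have hdiff : ∀ {T : ℝ → ℝ}, RadialWeight T → Differentiable ℝ T := fun hT =>
    hT.smooth.differentiable (by simp)
  have w1 : ∀ t : ℝ, 0 < t → RadialWeight
      (fun x => (t ^ 2)⁻¹ ^ ((m : ℝ) / 2) * boundaryWeight m (x / t ^ 2)) := fun t ht =>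
    (hw.comp_div (by positivity)).const_mul _
  have w2 := (w1 r hr).const_mul (-1)
  have hi : ∀ {T : ℝ → ℝ}, RadialWeight T →
      Integrable (fun z : Eu m => cutoffKernel a b c P v T z * G z) := fun hT =>
    let hk := hT.cutoffKernel_mul hG.continuous
    hk.1.integrable_of_hasCompactSupport hk.2
  rw [h.integral_symb_eq hm ha hb (radialWeight_annulusWeight (by positivity) (by gcongr))
    ((w1 R hR).add w2)
    (fun x hx => hasDerivAt_annulusWeight (by positivity) (by positivity) hx) hG]
  simp only [cutoffKernel_add (hdiff (w1 R hR)) (hdiff w2), add_mul]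
  rw [integral_add (hi (w1 R hR)) (hi w2), integral_cutoffKernel_rescale hR (hdiff hw)]
  have e : ∀ z : Eu m, cutoffKernel a b c P v
      (fun x => -1 * ((r ^ 2)⁻¹ ^ ((m : ℝ) / 2) * boundaryWeight m (x / r ^ 2))) z * G z =
      -(cutoffKernel a b c P v
        (fun x => (r ^ 2)⁻¹ ^ ((m : ℝ) / 2) * boundaryWeight m (x / r ^ 2)) z * G z) := fun z => by
    rw [cutoffKernel_const_mul (-1)]
    ring
  simp only [e]
  rw [integral_neg, integral_cutoffKernel_rescale hr (hdiff hw), sub_eq_add_neg]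

end CutoffKernel

end

section
open scoped ContDiff Topology
open Filter

section Limits

variable {m : ℕ} {K c : Eu m → ℝ}

lemma tendsto_integral_mul_comp_sub_smul (hK : Continuous K) (hs : HasCompactSupport K)
    (hc : Continuous c) (y : Eu m) :
    Tendsto (fun r : ℝ => ∫ z, K z * c (y - r • z)) (𝓝 0) (𝓝 ((∫ z, K z) * c y)) := by
  have h : ContinuousOn (fun r : ℝ => ∫ z, K z * c (y - r • z)) Set.univ := by
    refine continuousOn_integral_of_compact_support (k := tsupport K) hs ?_ fun r z _ hz => ?_
    · exact Continuous.continuousOn (by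
        simp only [Function.uncurry_def]
        fun_prop)
    · rw [image_eq_zero_of_notMem_tsupport hz, zero_mul]
  have h0 := (continuousOn_univ.1 h).tendsto 0
  simpa [integral_mul_const] using h0

open scoped Pointwise in
lemma tendsto_integral_abs_translate_sub (hK : Continuous K) (hs : HasCompactSupport K) :
    Tendsto (fun w : Eu m => ∫ z, |K (z + w) - K z|) (𝓝 0) (𝓝 0) := by
  have hk : IsCompact (tsupport K + Metric.closedBall (0 : Eu m) 1) :=
    hs.isCompact.add (isCompact_closedBall 0 1)
  have h : ContinuousOn (fun w : Eu m => ∫ z, |K (z + w) - K z|) (Metric.closedBall 0 1) := by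
    refine continuousOn_integral_of_compact_support hk ?_ fun w z hw hz => ?_
    · exact Continuous.continuousOn (by
        simp only [Function.uncurry_def]
        fun_prop)
    · have h1 : K (z + w) = 0 := image_eq_zero_of_notMem_tsupport fun h => hz
        ⟨z + w, h, -w, by simpa using hw, by simp⟩
      have h2 : K z = 0 := image_eq_zero_of_notMem_tsupport fun h => hz
        ⟨z, h, 0, by simp, by simp⟩
      simp [h1, h2]
  have h0 := (h.continuousAt (Metric.closedBall_mem_nhds 0 one_pos)).tendsto
  simpa using h0

lemma tendsto_integral_mul_comp_sub_smul_atTop (hK : Continuous K) (hs : HasCompactSupport K)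
    (hc : Continuous c) {C : ℝ} (hC : ∀ x, |c x| ≤ C) (y : Eu m) :
    Tendsto (fun r : ℝ => (∫ z, K z * c (y - r • z)) - ∫ z, K z * c (0 - r • z))
      atTop (𝓝 0) := by
  have hw : Tendsto (fun r : ℝ => r⁻¹ • y) atTop (𝓝 0) := by
    simpa using (tendsto_inv_atTop_zero (𝕜 := ℝ)).smul_const y
  have h1 := ((tendsto_integral_abs_translate_sub hK hs).comp hw).const_mul C
  rw [mul_zero] at h1
  refine squeeze_zero_norm' ?_ h1
  filter_upwards [eventually_gt_atTop 0] with r hr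
  have hs' : HasCompactSupport fun z => K (z + r⁻¹ • y) :=
    hs.comp_homeomorph (Homeomorph.addRight (r⁻¹ • y))
  have e1 : ∫ z, K z * c (y - r • z) = ∫ z, K (z + r⁻¹ • y) * c (0 - r • z) := by
    rw [← integral_add_right_eq_self (fun z => K z * c (y - r • z)) (r⁻¹ • y)]
    congr with z
    rw [smul_add, smul_inv_smul₀ hr.ne']
    congr 2
    abel
  have i1 : Integrable (fun z => K (z + r⁻¹ • y) * c (0 - r • z)) :=
    Continuous.integrable_of_hasCompactSupport (by fun_prop) hs'.mul_right
  have i2 : Integrable (fun z => K z * c (0 - r • z)) :=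
    Continuous.integrable_of_hasCompactSupport (by fun_prop) hs.mul_right
  have i3 : Integrable (fun z : Eu m => |K (z + r⁻¹ • y) - K z|) :=
    ((Continuous.integrable_of_hasCompactSupport (by fun_prop) hs').sub
      (hK.integrable_of_hasCompactSupport hs)).abs
  rw [e1, ← integral_sub i1 i2, Function.comp_apply, ← integral_const_mul]
  refine norm_integral_le_of_norm_le (i3.const_mul C) (ae_of_all _ fun z => ?_)
  rw [← sub_mul, norm_mul, mul_comm]
  exact mul_le_mul_of_nonneg_right (hC _) (norm_nonneg _)

end Limits

section RieszKernel

variable {m : ℕ}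

lemma integrable_norm_pow_inv_indicator (hm : 2 < m) (M : ℝ) :
    Integrable (fun z : Eu m => (Set.Iio M).indicator (fun t => (t ^ (m - 2))⁻¹) ‖z‖) := by
  have : Nontrivial (Eu m) := by
    have : Nonempty (Fin m) := ⟨⟨0, by omega⟩⟩
    infer_instance
  rw [integrable_fun_norm_addHaar volume (f := (Set.Iio M).indicator (fun t => (t ^ (m - 2))⁻¹)),
    finrank_euclideanSpace_fin]
  have h : IntegrableOn ((Set.Iio M).indicator fun t : ℝ => t) (Set.Ioi 0) := by
    rw [integrableOn_indicator_iff measurableSet_Iio, Set.inter_comm, Set.Ioi_inter_Iio]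
    exact (continuous_id.integrableOn_Icc (a := 0) (b := M)).mono_set Set.Ioo_subset_Icc_self
  refine h.congr_fun (fun t ht => ?_) measurableSet_Ioi
  have ht' : t ≠ 0 := (Set.mem_Ioi.1 ht).ne'
  by_cases htM : t ∈ Set.Iio M
  · rw [Set.indicator_of_mem htM, Set.indicator_of_mem htM, smul_eq_mul,
      show m - 1 = (m - 2) + 1 by omega, pow_succ]
    field_simp
  · rw [Set.indicator_of_notMem htM, Set.indicator_of_notMem htM, smul_zero]

/-- Bounded measurable functions of bounded support are integrable against the Riesz kernel. -/
lemma integrable_norm_pow_inv_mul (hm : 2 < m) {F : Eu m → ℝ} (hF : Measurable F) {C M : ℝ}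
    (hC : ∀ z, |F z| ≤ C) (hM : ∀ z, M ≤ ‖z‖ → F z = 0) :
    Integrable (fun z : Eu m => (‖z‖ ^ (m - 2))⁻¹ * F z) := by
  refine ((integrable_norm_pow_inv_indicator hm M).mul_const C).mono'
    (by fun_prop) (ae_of_all _ fun z => ?_)
  rw [norm_mul, norm_inv, norm_pow, norm_norm]
  by_cases hz : ‖z‖ ∈ Set.Iio M
  · rw [Set.indicator_of_mem hz]
    exact mul_le_mul_of_nonneg_left (hC z) (by positivity)
  · rw [Set.indicator_of_notMem hz, hM z (not_lt.1 hz)]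
    simp

lemma rpow_norm_sq {z : Eu m} (hm : 2 < m) (hz : z ≠ 0) :
    (‖z‖ ^ 2) ^ (1 - (m : ℝ) / 2) = (‖z‖ ^ (m - 2))⁻¹ := by
  have hz' : 0 < ‖z‖ := norm_pos_iff.2 hz
  rw [← Real.rpow_natCast, ← Real.rpow_mul hz'.le, ← Real.rpow_natCast, ← Real.rpow_neg hz'.le]
  congr 1
  push_cast [Nat.cast_sub hm.le]
  ring

lemma tendsto_integral_annulusWeight (hm : 2 < m) {F : Eu m → ℝ} (hF : Measurable F) {C M : ℝ}
    (hC : ∀ z, |F z| ≤ C) (hM : ∀ z, M ≤ ‖z‖ → F z = 0) {ι : Type*} {l : Filter ι}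
    [l.IsCountablyGenerated] {r R : ι → ℝ} (hr : Tendsto r l (𝓝[>] 0)) (hR : Tendsto R l atTop) :
    Tendsto (fun n => ∫ z : Eu m, annulusWeight m (r n ^ 2) (R n ^ 2) (‖z‖ ^ 2) * F z) l
      (𝓝 (∫ z : Eu m, (‖z‖ ^ (m - 2))⁻¹ * F z)) := by
  have hne := ae_ne_zero (m := m) (by omega)
  have hmeas : ∀ s t : ℝ, Measurable (annulusWeight m s t) := fun s t => by
    have := contDiff_stepDown.continuous.measurable
    unfold annulusWeight
    fun_prop
  refine tendsto_integral_filter_of_dominated_convergence _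
    (Eventually.of_forall fun n => ?_) (Eventually.of_forall fun n => ?_)
    (integrable_norm_pow_inv_mul hm hF hC hM).norm ?_
  · have := hmeas (r n ^ 2) (R n ^ 2)
    fun_prop
  · filter_upwards [hne] with z hz
    rw [norm_mul, norm_mul, ← rpow_norm_sq hm hz]
    refine mul_le_mul_of_nonneg_right ?_ (norm_nonneg _)
    exact (abs_annulusWeight_le (by positivity)).trans (le_abs_self _)
  · filter_upwards [hne] with z hz
    have hz' : 0 < ‖z‖ := norm_pos_iff.2 hz
    refine tendsto_const_nhds.congr' ?_
    have h1 : ∀ᶠ n in l, r n < ‖z‖ / 2 :=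
      (hr.mono_right nhdsWithin_le_nhds).eventually_lt_const (by positivity)
    filter_upwards [h1, hr.eventually self_mem_nhdsWithin, hR.eventually_ge_atTop ‖z‖]
      with n h1 h2 h3
    have h2' : 0 < r n := h2
    have h3' : 0 < R n := hz'.trans_le h3
    rw [annulusWeight_eq (by positivity) (by positivity) (by nlinarith) (by gcongr),
      rpow_norm_sq hm hz]

end RieszKernel

end

section
open scoped ContDiff Topology
open Filter

variable {m k : ℕ}

lemma pd_comp_const_sub {c : Eu m → ℝ} (hc : Differentiable ℝ c) (y : Eu m) (i : Fin m) :
    pd (fun z => c (y - z)) i = fun z => -pd c i (y - z) := by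
  funext z
  have h := (hc (y - z)).hasFDerivAt.comp z ((hasFDerivAt_id z).const_sub y)
  change fderiv ℝ (c ∘ HSub.hSub y) z _ = _
  rw [h.fderiv]
  simp [pd]

lemma pd_pd_comp_const_sub {c : Eu m → ℝ} (hc : ContDiff ℝ 2 c) (y : Eu m) (i j : Fin m) :
    pd (pd (fun z => c (y - z)) j) i = fun z => pd (pd c j) i (y - z) := by
  have hj := (contDiff_pd hc j).differentiable (by simp)
  rw [pd_comp_const_sub (hc.differentiable (by simp))]
  funext z
  have h := ((HasPD.of_differentiableAt (hj.comp (differentiable_id.const_sub y) z)).const_mul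
    (-1)).pd_eq i
  rw [show (fun z => -pd c j (y - z)) = fun z => -1 * (pd c j ∘ fun z => y - id z) z by
    funext z; simp, h]
  rw [show (pd c j ∘ fun z => y - id z) = fun z => pd c j (y - z) from rfl, pd_comp_const_sub hj]
  simp

lemma norm_reflVec (v z : Eu m) : ‖reflVec v z‖ = ‖v‖ := by
  by_cases hz : z = 0
  · simp [reflVec, hz]
  · have h := sum_reflVec_sq (v := v) hz
    rw [sum_sq_eq] at h
    exact (sq_eq_sq₀ (norm_nonneg _) (norm_nonneg _)).1 h

lemma measurable_reflVec (v : Eu m) : Measurable (reflVec v) := by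
  unfold reflVec
  fun_prop

/-- The potential of `f` for the reflected Riesz kernel. -/
def reflPotential (f : Eu m → Eu m → ℝ) (y v : Eu m) : ℝ :=
  ∫ z : Eu m, (‖z‖ ^ (m - 2))⁻¹ * f (y - z) (reflVec v z)

/-- The normalisation constant of the fundamental solution. -/
def greenConst (m k : ℕ) : ℝ :=
  -2 * (m - 2) * (m - 4) / (m + 2 * k - 4) * ∫ z : Eu m, boundaryWeight m (‖z‖ ^ 2)

lemma greenConst_ne_zero (hm : 4 < m) : greenConst m k ≠ 0 := by
  have hm' : (4 : ℝ) < m := by exact_mod_cast hm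
  have hk : (0 : ℝ) ≤ k := by positivity
  refine mul_ne_zero (div_ne_zero (mul_ne_zero (mul_ne_zero (by norm_num) ?_) ?_) ?_)
    (integral_boundaryWeight_ne_zero (by omega)) <;> linarith

section Bounds

variable {f : Eu m → Eu m → ℝ} {S : Set (Eu m)}

lemma ValuesInHk.continuous (hf : ValuesInHk m k (fun c => ContDiff ℝ 2 c) f) :
    Continuous fun p : Eu m × Eu m => f p.1 p.2 := by
  obtain ⟨s, q, -, hq⟩ := exists_interpolation m k
  rw [show (fun p : Eu m × Eu m => f p.1 p.2) = fun p => ∑ l ∈ s, f p.1 l * ev (q l) p.2 from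
    funext fun p => hf.eq_sum hq p.1 p.2]
  refine continuous_finsetSum _ fun l _ => ?_
  have h1 := (hf.contDiff l).continuous
  have h2 := (contDiff_ev (q l) (n := 0)).continuous
  fun_prop

lemma ValuesInHk.measurable_refl (hf : ValuesInHk m k (fun c => ContDiff ℝ 2 c) f) (y v : Eu m) :
    Measurable fun z => f (y - z) (reflVec v z) :=
  hf.continuous.measurable.comp ((measurable_const.sub measurable_id).prodMk (measurable_reflVec v))

lemma ValuesInHk.exists_bound (hf : ValuesInHk m k (fun c => ContDiff ℝ 2 c) f)
    (hS : IsCompact S) (hfS : ∀ x ∉ S, ∀ u, f x u = 0) (v : Eu m) :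
    ∃ C, ∀ y z, |f (y - z) (reflVec v z)| ≤ C := by
  obtain ⟨C, hC⟩ := (hS.prod (isCompact_closedBall (0 : Eu m) ‖v‖)).exists_bound_of_continuousOn
    hf.continuous.continuousOn
  refine ⟨max C 0, fun y z => ?_⟩
  by_cases hy : y - z ∈ S
  · exact (hC (y - z, reflVec v z) ⟨hy, by simp [norm_reflVec]⟩).trans (le_max_left _ _)
  · simp [hfS _ hy]

lemma exists_radius_eq_zero (hS : IsCompact S) (hfS : ∀ x ∉ S, ∀ u, f x u = 0) (y v : Eu m) :
    ∃ M : ℝ, ∀ z, M ≤ ‖z‖ → f (y - z) (reflVec v z) = 0 := by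
  obtain ⟨B, hB⟩ := hS.isBounded.subset_closedBall 0
  refine ⟨B + ‖y‖ + 1, fun z hz => hfS _ (fun h => ?_) _⟩
  have h1 := hB h
  have h2 := norm_sub_norm_le z y
  rw [mem_closedBall_zero_iff, norm_sub_rev] at h1
  linarith

end Bounds

section Green

variable {a b : ℝ} {f g : Eu m → Eu m → ℝ} {s : Finset {u : Eu m // ‖u‖ < 1}}
  {q : {u : Eu m // ‖u‖ < 1} → MvPolynomial (Fin m) ℝ}

lemma integral_annulusWeight_mul (hm : 4 < m) (hk : 1 ≤ k)
    (hqm : ∀ l, q l ∈ harmPoly m k) (hq : ∀ P ∈ harmPoly m k, P = ∑ l ∈ s, ev P l • q l)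
    (ha : a = 4 / ((m : ℝ) + 2 * k - 2))
    (hb : b = 4 / (((m : ℝ) + 2 * k - 2) * ((m : ℝ) + 2 * k - 4)))
    (hg : ValuesInHk m k (fun c => ContDiff ℝ 2 c) g)
    (hfg : ∀ y v, ‖v‖ < 1 → bosonicLaplacian m k g y v = f y v) {v : Eu m} (hv : ‖v‖ < 1)
    (y : Eu m) {r R : ℝ} (hr : 0 < r) (hrR : r ≤ R) :
    ∫ z : Eu m, annulusWeight m (r ^ 2) (R ^ 2) (‖z‖ ^ 2) * f (y - z) (reflVec v z) =
      ∑ l ∈ s, ((∫ z : Eu m, cutoffKernel a b k (q l) v (boundaryWeight m) z * g (y - R • z) l) -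
        ∫ z : Eu m, cutoffKernel a b k (q l) v (boundaryWeight m) z * g (y - r • z) l) := by
  have hm' : (4 : ℝ) < m := by exact_mod_cast hm
  have hk' : (1 : ℝ) ≤ k := by exact_mod_cast hk
  have h1 : (m : ℝ) + 2 * k - 2 ≠ 0 := by linarith
  have h2 : (m : ℝ) + 2 * k - 4 ≠ 0 := by linarith
  have hc : ∀ l, ContDiff ℝ 2 fun x => g x l := fun l => hg.contDiff l
  have hG : ∀ l : {u : Eu m // ‖u‖ < 1}, ContDiff ℝ 2 fun z => g (y - z) l := fun l =>
    (hc l).comp (contDiff_const.sub contDiff_id)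
  have hT := radialWeight_annulusWeight (m := m) (show 0 < r ^ 2 by positivity)
    (show r ^ 2 ≤ R ^ 2 by gcongr)
  have hgreen := fun l => HarmEuler.integral_annulusWeight (P := q l) (v := v) (a := a) (b := b)
    ⟨by simpa using (hqm l).1.sum_X_mul_pderiv, (hqm l).2⟩ (c := (k : ℝ)) (by omega)
    (by rw [ha]; field_simp) (by rw [ha, hb]; field_simp) hr hrR (hG l)
  simp only [← hgreen]
  rw [← integral_finsetSum]
  · refine integral_congr_ae ?_
    filter_upwards [ae_ne_zero (m := m) (by omega)] with z hz
    have hD : bosonicLaplacian m k g =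
        bosonicLaplacian m k fun x u => ∑ l ∈ s, g x l * ev (q l) u :=
      congrArg _ (funext fun x => funext fun u => hg.eq_sum hq x u)
    rw [← Finset.mul_sum, ← hfg _ _ (by rwa [norm_reflVec]), hD,
      bosonicLaplacian_sum (c := fun (l : {u : Eu m // ‖u‖ < 1}) x => g x l)
        (fun l _ => hc l) ha hb]
    simp only [pd_pd_comp_const_sub (hc _), symb, norm_reflVec]
  · intro l _
    refine hT.integrable fun z hz => ?_
    refine tendsto_finsetSum _ fun j _ => tendsto_finsetSum _ fun i _ => ?_
    refine ContinuousAt.mul (contDiffAt_symb (n := 0) hz j i).continuousAt ?_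
    have h3 : ContDiff ℝ 1 (pd (fun z => g (y - z) l) j) := contDiff_pd (hG l) j
    exact ((h3.continuous_fderiv one_ne_zero).clm_apply continuous_const).continuousAt

end Green

end

section
open scoped ContDiff Topology
open Filter

section Green

variable {m k : ℕ} {f g : Eu m → Eu m → ℝ}

lemma sum_integral_cutoffKernel_mul (hm : 4 < m) (hk : 1 ≤ k) {a b : ℝ}
    {s : Finset {u : Eu m // ‖u‖ < 1}} {q : {u : Eu m // ‖u‖ < 1} → MvPolynomial (Fin m) ℝ}
    (hqm : ∀ l, q l ∈ harmPoly m k) (hq : ∀ P ∈ harmPoly m k, P = ∑ l ∈ s, ev P l • q l)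
    (ha : a = 4 / ((m : ℝ) + 2 * k - 2))
    (hb : b = 4 / (((m : ℝ) + 2 * k - 2) * ((m : ℝ) + 2 * k - 4)))
    (hg : ValuesInHk m k (fun c => ContDiff ℝ 2 c) g) (y v : Eu m) :
    ∑ l ∈ s, (∫ z : Eu m, cutoffKernel a b k (q l) v (boundaryWeight m) z) * g y l =
      greenConst m k * g y v := by
  have hm' : (4 : ℝ) < m := by exact_mod_cast hm
  have hk' : (1 : ℝ) ≤ k := by exact_mod_cast hk
  have h1 : (m : ℝ) + 2 * k - 2 ≠ 0 := by linarith
  have h2 : (m : ℝ) + 2 * k - 4 ≠ 0 := by linarith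
  rw [hg.eq_sum hq y v, Finset.mul_sum]
  refine Finset.sum_congr rfl fun l _ => ?_
  have h := integral_cutoffKernel (a := a) (b := b) (v := v) hm
    (radialWeight_boundaryWeight (m := m)) k (hqm l).1 (hqm l).2
    (by rw [ha]; field_simp) (by rw [ha, hb]; field_simp)
  rw [greenConst, ← mul_right_inj' h2, ← mul_assoc, h]
  field_simp

lemma reflPotential_sub_eq (hm : 4 < m) (hk : 1 ≤ k)
    (hf : ValuesInHk m k (fun c => ContDiff ℝ 2 c) f)
    {S : Set (Eu m)} (hS : IsCompact S) (hfS : ∀ x ∉ S, ∀ u, f x u = 0)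
    (hg : ValuesInHk m k (fun c => ContDiff ℝ 2 c) g)
    {C : ℝ} (hC : ∀ y v, ‖v‖ < 1 → |g y v| ≤ C)
    (hfg : ∀ y v, ‖v‖ < 1 → bosonicLaplacian m k g y v = f y v) {v : Eu m} (hv : ‖v‖ < 1)
    (y : Eu m) :
    reflPotential f y v - reflPotential f 0 v = greenConst m k * (g 0 v - g y v) := by
  obtain ⟨s, q, hqm, hq⟩ := exists_interpolation m k
  set a : ℝ := 4 / ((m : ℝ) + 2 * k - 2) with ha
  set b : ℝ := 4 / (((m : ℝ) + 2 * k - 2) * ((m : ℝ) + 2 * k - 4)) with hb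
  have hr0 : Tendsto (fun R : ℝ => R⁻¹) atTop (𝓝[>] 0) := tendsto_inv_atTop_nhdsGT_zero
  set J : {u : Eu m // ‖u‖ < 1} → Eu m → ℝ → ℝ := fun l y r =>
    ∫ z : Eu m, cutoffKernel a b k (q l) v (boundaryWeight m) z * g (y - r • z) l with hJ
  have hK : ∀ l, Continuous (cutoffKernel a b k (q l) v (boundaryWeight m)) ∧
      HasCompactSupport (cutoffKernel a b k (q l) v (boundaryWeight m)) := fun l => by
    simpa using (radialWeight_boundaryWeight (m := m)).cutoffKernel_mul (a := a) (b := b) (c := k)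
      (v := v) (P := q l) (continuous_const (y := (1 : ℝ)))
  have hc : ∀ l, Continuous fun x => g x l := fun l => (hg.contDiff l).continuous
  have hpot : ∀ y, Tendsto (fun R : ℝ => ∑ l ∈ s, (J l y R - J l y R⁻¹)) atTop
      (𝓝 (reflPotential f y v)) := fun y => by
    obtain ⟨B, hB⟩ := hf.exists_bound hS hfS v
    obtain ⟨M, hM⟩ := exists_radius_eq_zero hS hfS y v
    refine (tendsto_integral_annulusWeight (by omega) (hf.measurable_refl y v) (hB y) hM hr0
      tendsto_id).congr' ?_
    filter_upwards [eventually_ge_atTop 1] with R hR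
    exact integral_annulusWeight_mul hm hk hqm hq ha hb hg hfg hv y (by positivity)
      ((inv_le_one_of_one_le₀ hR).trans hR)
  have hsmall : ∀ y, Tendsto (fun R : ℝ => ∑ l ∈ s, J l y R⁻¹) atTop
      (𝓝 (greenConst m k * g y v)) := fun y => by
    rw [← sum_integral_cutoffKernel_mul hm hk hqm hq ha hb hg y v]
    exact tendsto_finsetSum _ fun l _ => (tendsto_integral_mul_comp_sub_smul (hK l).1 (hK l).2
      (hc l) y).comp (hr0.mono_right nhdsWithin_le_nhds)
  have hlarge : Tendsto (fun R : ℝ => ∑ l ∈ s, (J l y R - J l 0 R)) atTop (𝓝 0) := by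
    have h := tendsto_finsetSum s fun l _ => tendsto_integral_mul_comp_sub_smul_atTop
      (hK l).1 (hK l).2 (hc l) (fun x => hC x l l.2) y
    rwa [Finset.sum_const_zero] at h
  have h := tendsto_nhds_unique (((hpot y).sub (hpot 0)).congr fun R => ?_)
    (hlarge.sub ((hsmall y).sub (hsmall 0)))
  · rw [h]; ring
  · simp only [Finset.sum_sub_distrib]; ring

end Green

end

section
open scoped ContDiff Topology
open Filter

section Rotation

variable {m k : ℕ}

lemma integral_sphereMeasure_comp (A : Eu m ≃ₗᵢ[ℝ] Eu m) (F : Eu m → ℝ) :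
    ∫ u : Metric.sphere (0 : Eu m) 1, F (A u) ∂sphereMeasure m =
      ∫ u : Metric.sphere (0 : Eu m) 1, F u ∂sphereMeasure m := by
  let e : Metric.sphere (0 : Eu m) 1 ≃ₜ Metric.sphere (0 : Eu m) 1 :=
    A.toHomeomorph.subtype fun u => by simp
  have he : MeasurePreserving e (sphereMeasure m) (sphereMeasure m) := by
    refine ⟨e.continuous.measurable, Measure.ext fun t ht => ?_⟩
    rw [Measure.map_apply e.continuous.measurable ht, sphereMeasure,
      Measure.toSphere_apply' _ (e.continuous.measurable ht), Measure.toSphere_apply' _ ht]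
    congr 1
    conv_rhs => rw [← A.measurePreserving.measure_preimage_equiv (f := A.toMeasurableEquiv)]
    congr 1
    ext x
    simp only [Set.mem_smul, Set.mem_image, Set.mem_preimage]
    constructor
    · rintro ⟨r, hr, _, ⟨u, hu, rfl⟩, rfl⟩
      exact ⟨r, hr, A u, ⟨e u, hu, rfl⟩, (map_smul A r (u : Eu m)).symm⟩
    · rintro ⟨r, hr, _, ⟨u, hu, rfl⟩, hx⟩
      refine ⟨r, hr, A.symm u, ⟨e.symm u, by simpa using hu, rfl⟩, ?_⟩
      rw [← map_smul, hx]
      exact A.symm_apply_apply x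
  exact he.integral_comp e.measurableEmbedding fun u => F u

lemma HasPD.linearIsometryEquiv (A : Eu m ≃ₗᵢ[ℝ] Eu m) (P : MvPolynomial (Fin m) ℝ) (u : Eu m) :
    HasPD (fun x => ev P (A x))
      (fun i => ∑ a, ev (MvPolynomial.pderiv a P) (A u) * A (EuclideanSpace.single i 1) a) u := by
  refine HasPD.ev_comp (fun a => ?_) P
  have h : HasFDerivAt (fun x => A x a)
      ((EuclideanSpace.proj a : Eu m →L[ℝ] ℝ).comp (A : Eu m →L[ℝ] Eu m)) u :=
    ((EuclideanSpace.proj a : Eu m →L[ℝ] ℝ).comp (A : Eu m →L[ℝ] Eu m)).hasFDerivAt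
  refine (HasPD.of_differentiableAt h.differentiableAt).congr_pd fun i => ?_
  simp [pd, h.fderiv]

lemma IsHarmPolyHom.comp_linearIsometryEquiv {p : Eu m → ℝ} (hp : IsHarmPolyHom m k p)
    (A : Eu m ≃ₗᵢ[ℝ] Eu m) : IsHarmPolyHom m k fun u => p (A u) := by
  obtain ⟨P, hP, rfl⟩ := isHarmPolyHom_iff.1 hp
  let q : Fin m → MvPolynomial (Fin m) ℝ := fun i =>
    ∑ j, MvPolynomial.C (A (EuclideanSpace.single j 1) i) * MvPolynomial.X j
  have hq : ∀ u i, MvPolynomial.eval (fun j => u j) (q i) = A u i := fun u i => by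
    have hu : u = ∑ j, u j • (EuclideanSpace.single j 1 : Eu m) := by
      ext l
      simp [WithLp.ofLp_sum, Finset.sum_apply, Pi.single_apply]
    conv_rhs => rw [hu, map_sum]
    simp [q, mul_comm]
  have hQ : ∀ u, ev (MvPolynomial.aeval q P) u = ev P (A u) := fun u => by
    simp only [ev, ← hq u]
    rw [← MvPolynomial.coe_aeval_eq_eval, ← MvPolynomial.coe_aeval_eq_eval]
    exact (DFunLike.congr_fun (MvPolynomial.comp_aeval q (MvPolynomial.aeval fun j => u j)) P)
  refine isHarmPolyHom_iff.2 ⟨MvPolynomial.aeval q P, ⟨?_, ?_⟩, (funext hQ).symm⟩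
  · rw [← one_mul k]
    refine hP.1.aeval q fun i => MvPolynomial.IsHomogeneous.sum _ _ _ fun j _ => ?_
    simpa using (MvPolynomial.isHomogeneous_C _ _).mul (MvPolynomial.isHomogeneous_X ℝ j)
  · refine ev_injective fun u => ?_
    have hO : ∀ a b, ∑ i, A (EuclideanSpace.single i 1) b * A (EuclideanSpace.single i 1) a =
        if b = a then 1 else 0 := fun a b => by
      have h1 : ∀ i c, A (EuclideanSpace.single i 1) c = A.symm (EuclideanSpace.single c 1) i := by
        intro i c
        have := A.inner_map_map (EuclideanSpace.single i 1) (A.symm (EuclideanSpace.single c 1))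
        simpa [EuclideanSpace.inner_single_left, EuclideanSpace.inner_single_right] using this
      have h2 := A.symm.inner_map_map (EuclideanSpace.single b 1) (EuclideanSpace.single a 1)
      simp only [h1]
      rw [EuclideanSpace.inner_single_left, PiLp.inner_apply] at h2
      simpa [Pi.single_apply, mul_comm, eq_comm] using h2
    have h1 : ∀ i, ev (MvPolynomial.pderiv i (MvPolynomial.pderiv i (MvPolynomial.aeval q P))) u =
        ∑ a, ∑ b, ev (MvPolynomial.pderiv b (MvPolynomial.pderiv a P)) (A u) *
          (A (EuclideanSpace.single i 1) b * A (EuclideanSpace.single i 1) a) := fun i => by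
      rw [← pd_pd_ev, show ev (MvPolynomial.aeval q P) = fun x => ev P (A x) from funext hQ,
        show pd (fun x => ev P (A x)) i = fun x => ∑ a, A (EuclideanSpace.single i 1) a *
          ev (MvPolynomial.pderiv a P) (A x) from funext fun x =>
            ((HasPD.linearIsometryEquiv A P x).pd_eq i).trans
              (Finset.sum_congr rfl fun a _ => mul_comm _ _),
        (HasPD.sum _ fun a _ => (HasPD.linearIsometryEquiv A _ u).const_mul _).pd_eq i]
      refine Finset.sum_congr rfl fun a _ => ?_
      rw [Finset.mul_sum]
      exact Finset.sum_congr rfl fun b _ => by ring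
    rw [ev_sum, Finset.sum_congr rfl fun i _ => h1 i, Finset.sum_comm]
    have h2 : ∀ a, ∑ i, ∑ b, ev (MvPolynomial.pderiv b (MvPolynomial.pderiv a P)) (A u) *
        (A (EuclideanSpace.single i 1) b * A (EuclideanSpace.single i 1) a) =
        ev (MvPolynomial.pderiv a (MvPolynomial.pderiv a P)) (A u) := fun a => by
      rw [Finset.sum_comm]
      simp only [← Finset.mul_sum, hO]
      simp
    rw [Finset.sum_congr rfl fun a _ => h2 a, ← ev_sum, hP.2]
    simp [ev]

lemma reflection_eq_reflVec (u w : Eu m) : (ℝ ∙ w)ᗮ.reflection u = reflVec u w := by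
  rw [Submodule.reflection_orthogonal_apply, Submodule.reflection_singleton_apply, reflVec,
    real_inner_comm, neg_sub, mul_div_assoc, mul_smul, two_smul, two_smul]
  rfl

lemma IsHarmPolyHom.comp_reflVec {p : Eu m → ℝ} (hp : IsHarmPolyHom m k p) (w : Eu m) :
    IsHarmPolyHom m k fun u => p (reflVec u w) := by
  simpa only [reflection_eq_reflVec] using hp.comp_linearIsometryEquiv (ℝ ∙ w)ᗮ.reflection

lemma IsZonalHarmonic.integral_reflVec_mul {Zk : Eu m → Eu m → ℝ} (hZk : IsZonalHarmonic m k Zk)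
    {p : Eu m → ℝ} (hp : IsHarmPolyHom m k p) (w v : Eu m) :
    ∫ u : Metric.sphere (0 : Eu m) 1, Zk (reflVec u w) v * p u ∂sphereMeasure m =
      p (reflVec v w) := by
  rw [← hZk.2 _ (hp.comp_reflVec w) v,
    ← integral_sphereMeasure_comp (ℝ ∙ w)ᗮ.reflection fun u => Zk u v * p (reflVec u w)]
  simp only [← reflection_eq_reflVec, Submodule.reflection_reflection]

lemma IsZonalHarmonic.poissonPotential_eq {Zk : Eu m → Eu m → ℝ} (hZk : IsZonalHarmonic m k Zk)
    {f : Eu m → Eu m → ℝ} (hf : ∀ x, IsHarmPolyHom m k (f x)) (c : ℝ) (y v : Eu m) :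
    poissonPotential m k c Zk f y v = c * reflPotential f y v := by
  have h : ∀ x, (∫ u : Metric.sphere (0 : Eu m) 1, c * (‖y - x‖ ^ (m - 2))⁻¹ *
      Zk (reflVec u (y - x)) v * f x u ∂sphereMeasure m) =
      c * ((‖y - x‖ ^ (m - 2))⁻¹ * f (y - (y - x)) (reflVec v (y - x))) := fun x => by
    simp_rw [mul_assoc]
    rw [integral_const_mul, integral_const_mul, hZk.integral_reflVec_mul (hf x), sub_sub_cancel]
  rw [poissonPotential, reflPotential, ← integral_const_mul]
  exact (integral_congr_ae (Eventually.of_forall h)).trans (integral_sub_left_eq_self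
    (fun z => c * ((‖z‖ ^ (m - 2))⁻¹ * f (y - z) (reflVec v z))) volume y)

lemma isHarmPolyHom_reflPotential {f : Eu m → Eu m → ℝ} (hm : 2 < m)
    (hf : ValuesInHk m k (fun c => ContDiff ℝ 2 c) f)
    {S : Set (Eu m)} (hS : IsCompact S) (hfS : ∀ x ∉ S, ∀ u, f x u = 0) (y : Eu m) :
    IsHarmPolyHom m k (reflPotential f y) := by
  obtain ⟨s, q, hqm, hq⟩ := exists_interpolation m k
  refine isHarmPolyHom_iff.2 ⟨∑ l ∈ s, reflPotential f y l • q l,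
    Submodule.sum_mem _ fun l _ => Submodule.smul_mem _ _ (hqm l), funext fun v => ?_⟩
  have h : ∀ z, f (y - z) (reflVec v z) = ∑ l ∈ s, f (y - z) (reflVec l z) * ev (q l) v := by
    intro z
    obtain ⟨P, hP, he⟩ := isHarmPolyHom_iff.1 ((hf.isHarmPolyHom (y - z)).comp_reflVec z)
    have h1 : ∀ u, f (y - z) (reflVec u z) = ev P u := congrFun he
    simp only [h1]
    conv_lhs => rw [hq P hP, ev_sum]
    simp only [ev_smul]
  have hI : ∀ u : Eu m, Integrable fun z => (‖z‖ ^ (m - 2))⁻¹ * f (y - z) (reflVec u z) := by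
    intro u
    obtain ⟨B, hB⟩ := hf.exists_bound hS hfS u
    obtain ⟨M, hM⟩ := exists_radius_eq_zero hS hfS y u
    exact integrable_norm_pow_inv_mul hm (hf.measurable_refl y u) (hB y) hM
  simp only [ev_sum, ev_smul, reflPotential, h, Finset.mul_sum, ← integral_mul_const, ← mul_assoc]
  exact integral_finsetSum _ fun l _ => (hI l).mul_const _

end Rotation

end

/-- Representation formula for bounded solutions of `D_k g = f` (`m > 4`):  there is a
nonzero constant `c_{m,k}` such that any solution `g`, bounded on `ℝ^m × B^m`, of
`D_k g = f` on `ℝ^m × B^m` differs from the potential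
`∫∫ c |y-x|^{2-m} Z_k((y-x)u(y-x)/|y-x|², v) f(x,u) dS(u) dx`
by a harmonic polynomial `h(v)` homogeneous of degree `k`. -/
theorem representation_formula_bounded (m k : ℕ) (hm : 4 < m) (hk : 1 ≤ k)
    (Zk : EuclideanSpace ℝ (Fin m) → EuclideanSpace ℝ (Fin m) → ℝ)
    (hZk : IsZonalHarmonic m k Zk) :
    ∃ c : ℝ, c ≠ 0 ∧
      ∀ f g : EuclideanSpace ℝ (Fin m) → EuclideanSpace ℝ (Fin m) → ℝ,
        ValuesInHk m k (fun c' => ContDiff ℝ 2 c') f →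
        (∃ K : Set (EuclideanSpace ℝ (Fin m)), IsCompact K ∧ ∀ x ∉ K, ∀ u, f x u = 0) →
        ValuesInHk m k (fun c' => ContDiff ℝ 2 c') g →
        (∃ C : ℝ, ∀ y v, ‖v‖ < 1 → |g y v| ≤ C) →
        (∀ y v, ‖v‖ < 1 → bosonicLaplacian m k g y v = f y v) →
        ∃ h : EuclideanSpace ℝ (Fin m) → ℝ, IsHarmPolyHom m k h ∧
          ∀ y v, ‖v‖ < 1 →
            g y v = poissonPotential m k c Zk f y v + h v := by
  have hG := greenConst_ne_zero (k := k) hm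
  refine ⟨-(greenConst m k)⁻¹, neg_ne_zero.2 (inv_ne_zero hG), ?_⟩
  rintro f g hf ⟨S, hS, hfS⟩ hg ⟨C, hC⟩ hfg
  obtain ⟨P, hP, hgP⟩ := isHarmPolyHom_iff.1 (hg.isHarmPolyHom 0)
  obtain ⟨Q, hQ, hfQ⟩ := isHarmPolyHom_iff.1
    (isHarmPolyHom_reflPotential (by omega) hf hS hfS 0)
  refine ⟨ev (P + (greenConst m k)⁻¹ • Q), isHarmPolyHom_iff.2 ⟨_, Submodule.add_mem _ hP
    (Submodule.smul_mem _ _ hQ), rfl⟩, fun y v hv => ?_⟩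
  have h := reflPotential_sub_eq hm hk hf hS hfS hg hC hfg hv y
  rw [hZk.poissonPotential_eq hf.isHarmPolyHom, ev_add, ev_smul, ← hgP, ← hfQ]
  field_simp
  linarith
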